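/- arXiv:2302.09962 — 4 statements merged into one kernel-verified Lean document; each statement's English description precedes it below -/
import Mathlib

section
/- Let M ≥ 0 and 0 ≤ θ < π/2 be fixed real numbers. For r with |r| ≤ M, y > 0, t = y sin θ and ν = r + it, one has K_ν(y) ∼ sqrt(π/(2 y cos θ)) · exp(−y(cos θ + θ sin θ)) · exp(i r θ) as y → ∞ (that is, the ratio of the two sides tends to 1). -/
open MeasureTheory Filter Topology

/-- The K-Bessel function, defined via the integral representation
`K_ν(y) = (1/2) ∫_{-∞}^{∞} exp(−y cosh R + ν R) dR`. -/
noncomputable def KBessel (ν : ℂ) (y : ℝ) : ℂ :=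
  (1 / 2) * ∫ R : ℝ, Complex.exp (-(y : ℂ) * (Real.cosh R : ℂ) + ν * (R : ℂ))

theorem integral_comp_add_mul_I_eq {G : ℂ → ℂ} (hG : Differentiable ℂ G) {a b C : ℝ} (ha : 0 ≤ a)
    (hb : 0 < b)
    (hB : ∀ x s : ℝ, s ∈ Set.Icc 0 a → ‖G (x + s * Complex.I)‖ ≤ C * Real.exp (-b * x ^ 2)) :
    ∫ x : ℝ, G (x + a * Complex.I) = ∫ x : ℝ, G x := by
  have hc : Continuous G := hG.continuous
  have hint (s : ℝ) (hs : s ∈ Set.Icc 0 a) : Integrable fun x : ℝ => G (x + s * Complex.I) :=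
    ((integrable_exp_neg_mul_sq hb).const_mul C).mono'
      (by fun_prop : Continuous fun x : ℝ => G (x + s * Complex.I)).aestronglyMeasurable
      (Eventually.of_forall fun x => hB x s hs)
  have h0 : Integrable fun x : ℝ => G x := by simpa using hint 0 ⟨le_rfl, ha⟩
  have l1 := intervalIntegral_tendsto_integral (hint a ⟨ha, le_rfl⟩) tendsto_neg_atTop_atBot tendsto_id
  have l0 := intervalIntegral_tendsto_integral h0 tendsto_neg_atTop_atBot tendsto_id
  have hdecay : Tendsto (fun T : ℝ => C * Real.exp (-b * T ^ 2) * |a - 0|) atTop (𝓝 0) := by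
    have h : Tendsto (fun T : ℝ => -b * T ^ 2) atTop atBot :=
      (tendsto_pow_atTop two_ne_zero).const_mul_atTop_of_neg (neg_neg_of_pos hb)
    simpa using ((Real.tendsto_exp_atBot.comp h).const_mul C).mul_const |a - 0|
  have hmem {y : ℝ} (hy : y ∈ Set.uIoc 0 a) : y ∈ Set.Icc 0 a := by
    rw [Set.uIoc_of_le ha] at hy
    exact Set.Ioc_subset_Icc_self hy
  have v1 : Tendsto (fun T : ℝ => ∫ y in (0 : ℝ)..a, G ((T : ℂ) + y * Complex.I)) atTop (𝓝 0) :=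
    squeeze_zero_norm (fun T => intervalIntegral.norm_integral_le_of_norm_le_const
      fun y hy => hB T y (hmem hy)) hdecay
  have v0 : Tendsto (fun T : ℝ => ∫ y in (0 : ℝ)..a, G (-(T : ℂ) + y * Complex.I)) atTop (𝓝 0) :=
    squeeze_zero_norm (fun T => intervalIntegral.norm_integral_le_of_norm_le_const
      fun y hy => by simpa using hB (-T) y (hmem hy)) hdecay
  have key (T : ℝ) : (∫ x in -T..T, G (x : ℂ)) - (∫ x in -T..T, G (x + a * Complex.I)) +
      Complex.I * (∫ y in (0 : ℝ)..a, G ((T : ℂ) + y * Complex.I)) -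
      Complex.I * (∫ y in (0 : ℝ)..a, G (-(T : ℂ) + y * Complex.I)) = 0 := by
    simpa using Complex.integral_boundary_rect_eq_zero_of_differentiableOn G (-(T : ℂ))
      (T + a * Complex.I) hG.differentiableOn
  have hlim := ((l0.sub l1).add (v1.const_mul Complex.I)).sub (v0.const_mul Complex.I)
  simp only [id, key, mul_zero, add_zero, sub_zero] at hlim
  exact (sub_eq_zero.1 (tendsto_nhds_unique hlim tendsto_const_nhds)).symm

theorem Real.one_add_sq_div_two_le_cosh (x : ℝ) : 1 + x ^ 2 / 2 ≤ Real.cosh x := by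
  have h1 : Real.cosh x = 1 + 2 * Real.sinh (x / 2) ^ 2 := by
    rw [← mul_div_cancel₀ x (two_ne_zero' ℝ), mul_div_assoc, Real.cosh_two_mul, Real.cosh_sq]
    ring_nf
  have h2 : (x / 2) ^ 2 ≤ Real.sinh (x / 2) ^ 2 := by
    rcases le_total 0 (x / 2) with h | h
    · nlinarith [Real.self_le_sinh_iff.2 h]
    · nlinarith [Real.sinh_le_self_iff.2 h]
  linarith

theorem neg_mul_sq_add_mul_le {c : ℝ} (hc : 0 < c) (r x : ℝ) :
    -(c * (x ^ 2 / 2)) + r * x ≤ r ^ 2 / c + -(c / 4) * x ^ 2 := by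
  have h : r ^ 2 / c - r * x + c / 4 * x ^ 2 = (r - c / 2 * x) ^ 2 / c := by
    field_simp
    ring
  have : 0 ≤ (r - c / 2 * x) ^ 2 / c := by positivity
  linarith

theorem abs_exp_sub_quadratic_le {x : ℝ} (hx : |x| ≤ 1) :
    |Real.exp x - (1 + x + x ^ 2 / 2)| ≤ |x| ^ 3 := by
  have h := Real.exp_bound hx (n := 3) (by norm_num)
  simp [Finset.sum_range_succ, Nat.factorial] at h
  have : 0 ≤ |x| ^ 3 := by positivity
  linarith

theorem Real.abs_cosh_sub_le {x : ℝ} (hx : |x| ≤ 1) :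
    |Real.cosh x - (1 + x ^ 2 / 2)| ≤ |x| ^ 3 := by
  have h1 := abs_le.1 (abs_exp_sub_quadratic_le hx)
  have h2 := abs_le.1 (abs_exp_sub_quadratic_le (x := -x) (by simpa using hx))
  rw [abs_neg, neg_sq] at h2
  rw [Real.cosh_eq, abs_le]
  constructor <;> linarith

theorem Real.abs_sinh_sub_self_le {x : ℝ} (hx : |x| ≤ 1) : |Real.sinh x - x| ≤ |x| ^ 3 := by
  have h1 := abs_le.1 (abs_exp_sub_quadratic_le hx)
  have h2 := abs_le.1 (abs_exp_sub_quadratic_le (x := -x) (by simpa using hx))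
  rw [abs_neg, neg_sq] at h2
  rw [Real.sinh_eq, abs_le]
  constructor <;> linarith

theorem tendsto_mul_comp_div_sqrt {g : ℝ → ℝ} (hg : ∀ x, |x| ≤ 1 → |g x| ≤ |x| ^ 3) (u : ℝ) :
    Tendsto (fun y : ℝ => y * g (u / √y)) atTop (𝓝 0) := by
  have hd : Tendsto (fun y : ℝ => u / √y) atTop (𝓝 0) :=
    Real.tendsto_sqrt_atTop.const_div_atTop u
  have h3 : Tendsto (fun y : ℝ => |u| ^ 3 / √y) atTop (𝓝 0) :=
    Real.tendsto_sqrt_atTop.const_div_atTop _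
  have hsmall : ∀ᶠ y : ℝ in atTop, |u / √y| < 1 :=
    (by simpa using hd.abs : Tendsto (fun y : ℝ => |u / √y|) atTop (𝓝 0)).eventually_lt_const
      one_pos
  refine squeeze_zero_norm' ?_ h3
  filter_upwards [hsmall, eventually_gt_atTop 0] with y hy hy0
  have hs : 0 < √y := Real.sqrt_pos.2 hy0
  rw [Real.norm_eq_abs, abs_mul, abs_of_pos hy0]
  calc y * |g (u / √y)| ≤ y * |u / √y| ^ 3 := by gcongr; exact hg _ hy.le
    _ = |u| ^ 3 / √y := by
      rw [abs_div, abs_of_pos hs]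
      field_simp
      rw [Real.sq_sqrt hy0.le, mul_comm]

/-- The phase of the `K`-Bessel integrand on the shifted contour `Im z = θ`, centred at its critical
point, where `c = cos θ` and `s = sin θ`. -/
noncomputable def shiftedPhase (c s r y x : ℝ) : ℂ :=
  ((-(y * c * (Real.cosh x - 1)) + r * x : ℝ) : ℂ) -
    ((s * (y * (Real.sinh x - x)) : ℝ) : ℂ) * Complex.I

theorem tendsto_shiftedPhase (c s r u : ℝ) :
    Tendsto (fun y : ℝ => shiftedPhase c s r y (u / √y)) atTop
      (𝓝 ((-(c / 2) * u ^ 2 : ℝ) : ℂ)) := by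
  have hd : Tendsto (fun y : ℝ => u / √y) atTop (𝓝 0) :=
    Real.tendsto_sqrt_atTop.const_div_atTop u
  have h1 := tendsto_mul_comp_div_sqrt
    (g := fun x => Real.cosh x - (1 + x ^ 2 / 2)) (fun x hx => Real.abs_cosh_sub_le hx) u
  have h2 := tendsto_mul_comp_div_sqrt
    (g := fun x => Real.sinh x - x) (fun x hx => Real.abs_sinh_sub_self_le hx) u
  have hre : Tendsto (fun y : ℝ => -(y * c * (Real.cosh (u / √y) - 1)) + r * (u / √y)) atTop
      (𝓝 (-(c / 2) * u ^ 2)) := by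
    have := ((h1.const_mul (-c)).add (hd.const_mul r)).const_add (-(c / 2) * u ^ 2)
    simp only [mul_zero, add_zero] at this
    refine this.congr' ?_
    filter_upwards [eventually_gt_atTop 0] with y hy
    have : y * (u / √y) ^ 2 = u ^ 2 := by
      rw [div_pow, Real.sq_sqrt hy.le]
      field_simp
    linear_combination (-(c / 2)) * this.symm
  have him := h2.const_mul s
  have := ((Complex.continuous_ofReal.tendsto _).comp hre).sub
    (((Complex.continuous_ofReal.tendsto _).comp him).mul_const Complex.I)
  simpa [shiftedPhase, Function.comp_def] using this

theorem norm_cexp_shiftedPhase_le {c y : ℝ} (hc : 0 < c) (hy : 1 ≤ y) (s r u : ℝ) :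
    ‖Complex.exp (shiftedPhase c s r y (u / √y))‖ ≤
      Real.exp (r ^ 2 / c) * Real.exp (-(c / 4) * u ^ 2) := by
  have hy0 : 0 < y := one_pos.trans_le hy
  have hsq : y * (u / √y) ^ 2 = u ^ 2 := by
    rw [div_pow, Real.sq_sqrt hy0.le]
    field_simp
  rw [Complex.norm_exp, ← Real.exp_add]
  gcongr
  simp only [shiftedPhase, Complex.sub_re, Complex.ofReal_re, Complex.re_ofReal_mul, Complex.I_re,
    mul_zero, sub_zero]
  have h1 := Real.one_add_sq_div_two_le_cosh (u / √y)
  have h2 := neg_mul_sq_add_mul_le (c := y * c) (by positivity) r (u / √y)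
  have h3 : y * c * ((u / √y) ^ 2 / 2) ≤ y * c * (Real.cosh (u / √y) - 1) := by
    gcongr
    linarith
  have h4 : r ^ 2 / (y * c) ≤ r ^ 2 / c := by
    gcongr
    nlinarith
  have h5 : -(y * c / 4) * (u / √y) ^ 2 = -(c / 4) * u ^ 2 := by
    linear_combination (-(c / 4)) * hsq
  linarith

theorem continuous_cexp_shiftedPhase (c s r y : ℝ) :
    Continuous fun x : ℝ => Complex.exp (shiftedPhase c s r y x) := by
  unfold shiftedPhase
  have := Real.continuous_cosh
  have := Real.continuous_sinh
  fun_prop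

theorem tendsto_sqrt_mul_integral_cexp_shiftedPhase {c : ℝ} (hc : 0 < c) (s r : ℝ) :
    Tendsto (fun y : ℝ => ((√y : ℝ) : ℂ) * ∫ x : ℝ, Complex.exp (shiftedPhase c s r y x)) atTop
      (𝓝 ((√(Real.pi / (c / 2)) : ℝ) : ℂ)) := by
  have h : Tendsto (fun y : ℝ => ∫ u : ℝ, Complex.exp (shiftedPhase c s r y (u / √y))) atTop
      (𝓝 (∫ u : ℝ, Complex.exp ((-(c / 2) * u ^ 2 : ℝ) : ℂ))) := by
    refine tendsto_integral_filter_of_dominated_convergence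
      (fun u => Real.exp (r ^ 2 / c) * Real.exp (-(c / 4) * u ^ 2)) ?_ ?_ ?_ ?_
    · exact Eventually.of_forall fun y => ((continuous_cexp_shiftedPhase c s r y).comp
        (continuous_id.div_const _)).aestronglyMeasurable
    · filter_upwards [eventually_ge_atTop 1] with y hy
      exact Eventually.of_forall fun u => norm_cexp_shiftedPhase_le hc hy s r u
    · exact (integrable_exp_neg_mul_sq (by positivity)).const_mul _
    · exact Eventually.of_forall fun u => (tendsto_shiftedPhase c s r u).cexp
  simp only [← Complex.ofReal_exp] at h
  rw [integral_complex_ofReal, integral_gaussian] at h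
  refine h.congr fun y => ?_
  rw [Measure.integral_comp_div (fun x => Complex.exp (shiftedPhase c s r y x)),
    abs_of_nonneg (Real.sqrt_nonneg y), Complex.real_smul]

theorem KBessel_eq_integral_shiftedPhase {θ y : ℝ} (hθ0 : 0 ≤ θ) (hθ : θ < Real.pi / 2)
    (hy : 0 < y) (r : ℝ) :
    KBessel ((r : ℂ) + ((y * Real.sin θ : ℝ) : ℂ) * Complex.I) y =
      1 / 2 * (Complex.exp ((-(y * (Real.cos θ + θ * Real.sin θ)) : ℝ) : ℂ) *
        Complex.exp (Complex.I * (r : ℂ) * (θ : ℂ)) *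
        ∫ x : ℝ, Complex.exp (shiftedPhase (Real.cos θ) (Real.sin θ) r y x)) := by
  have hc : 0 < Real.cos θ := Real.cos_pos_of_mem_Ioo ⟨by linarith [Real.pi_pos], hθ⟩
  have hs : 0 ≤ Real.sin θ := Real.sin_nonneg_of_nonneg_of_le_pi hθ0 (by linarith [Real.pi_pos])
  let G : ℂ → ℂ := fun z => Complex.exp (-(y : ℂ) * Complex.cosh z +
    ((r : ℂ) + ((y * Real.sin θ : ℝ) : ℂ) * Complex.I) * z)
  have hG : Differentiable ℂ G := by
    have := Complex.differentiable_cosh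
    fun_prop
  have hcosh (x s : ℝ) : Complex.cosh (x + s * Complex.I) =
      ((Real.cosh x * Real.cos s : ℝ) : ℂ) + ((Real.sinh x * Real.sin s : ℝ) : ℂ) * Complex.I := by
    rw [Complex.cosh_add, Complex.cosh_mul_I, Complex.sinh_mul_I]
    push_cast
    ring
  have hshift := integral_comp_add_mul_I_eq hG hθ0 (b := y * Real.cos θ / 4)
    (C := Real.exp (r ^ 2 / (y * Real.cos θ))) (by positivity) (fun x s hs' => by
      rw [Complex.norm_exp, ← Real.exp_add]
      gcongr
      rw [hcosh]
      simp only [Complex.add_re, Complex.mul_re, Complex.neg_re, Complex.neg_im, Complex.ofReal_re,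
        Complex.ofReal_im, Complex.add_im, Complex.mul_im, Complex.I_re, Complex.I_im]
      have h1 := Real.one_add_sq_div_two_le_cosh x
      have h2 := neg_mul_sq_add_mul_le (c := y * Real.cos θ) (by positivity) r x
      have h3 : Real.cos θ ≤ Real.cos s :=
        Real.cos_le_cos_of_nonneg_of_le_pi hs'.1 (by linarith [Real.pi_pos]) hs'.2
      have h4 : y * (x ^ 2 / 2 * Real.cos θ) ≤ y * (Real.cosh x * Real.cos s) := by
        gcongr
        linarith
      have h5 : 0 ≤ y * Real.sin θ * s := mul_nonneg (mul_nonneg hy.le hs) hs'.1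
      linarith)
  have hK : KBessel ((r : ℂ) + ((y * Real.sin θ : ℝ) : ℂ) * Complex.I) y =
      1 / 2 * ∫ x : ℝ, G x := by
    simp only [KBessel, G, Complex.ofReal_cosh]
  rw [hK, ← hshift]
  congr 1
  rw [← integral_const_mul]
  congr 1 with x
  simp only [G]
  rw [hcosh, ← Complex.exp_add, ← Complex.exp_add, shiftedPhase]
  congr 1
  push_cast
  linear_combination (y : ℂ) * Complex.sin θ * θ * Complex.I_sq

theorem kbessel_asymptotic_monotone_case (M θ : ℝ) (hM : 0 ≤ M) (hθ0 : 0 ≤ θ)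
    (hθ : θ < Real.pi / 2) (r : ℝ) (hr : |r| ≤ M) :
    Tendsto (fun y : ℝ =>
      KBessel ((r : ℂ) + ((y * Real.sin θ : ℝ) : ℂ) * Complex.I) y /
        (((Real.sqrt (Real.pi / (2 * y * Real.cos θ)) : ℝ) : ℂ) *
          Complex.exp (((-(y * (Real.cos θ + θ * Real.sin θ)) : ℝ) : ℂ)) *
          Complex.exp (Complex.I * (r : ℂ) * (θ : ℂ))))
      atTop (𝓝 1) := by
  have hc : 0 < Real.cos θ := Real.cos_pos_of_mem_Ioo ⟨by linarith [Real.pi_pos], hθ⟩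
  have hne : ((√(Real.pi / (Real.cos θ / 2)) : ℝ) : ℂ) ≠ 0 := by
    rw [Complex.ofReal_ne_zero]
    positivity
  have hlim := (tendsto_sqrt_mul_integral_cexp_shiftedPhase hc (Real.sin θ) r).div_const
    ((√(Real.pi / (Real.cos θ / 2)) : ℝ) : ℂ)
  rw [div_self hne] at hlim
  refine hlim.congr' ?_
  filter_upwards [eventually_gt_atTop 0] with y hy
  have hsy : ((√y : ℝ) : ℂ) ≠ 0 := by
    rw [Complex.ofReal_ne_zero]
    positivity
  have hsqrt : √(Real.pi / (2 * y * Real.cos θ)) = √(Real.pi / (Real.cos θ / 2)) / (2 * √y) := by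
    have h4 : 2 * √y = √(4 * y) := by
      rw [Real.sqrt_mul (by norm_num), show (4 : ℝ) = 2 ^ 2 by norm_num,
        Real.sqrt_sq (by norm_num)]
    rw [h4, ← Real.sqrt_div (by positivity)]
    congr 1
    field_simp
    norm_num
  rw [KBessel_eq_integral_shiftedPhase hθ0 hθ hy, hsqrt, Complex.ofReal_div, Complex.ofReal_mul,
    Complex.ofReal_ofNat]
  have he1 := Complex.exp_ne_zero ((-(y * (Real.cos θ + θ * Real.sin θ)) : ℝ) : ℂ)
  have he2 := Complex.exp_ne_zero (Complex.I * (r : ℂ) * (θ : ℂ))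
  generalize Complex.exp ((-(y * (Real.cos θ + θ * Real.sin θ)) : ℝ) : ℂ) = e1 at he1 ⊢
  generalize Complex.exp (Complex.I * (r : ℂ) * (θ : ℂ)) = e2 at he2 ⊢
  field_simp
end

section
/- Let μ > 0 be fixed, y > 0, t = y cosh μ, r ∈ ℝ, ν = r + it, χ := y(sinh μ − μ cosh μ), and ψ(u) := cosh u · cos w(u) + w(u) · cosh μ evaluated along the indicated branch. Then K_ν(y) = (1/2) e^{iχ} ∫_{μ}^{∞} e^{−yψ(u)} e^{−ru} e^{irw_A(u)} (1 − i w_A'(u)) du + (1/2) e^{−iχ} ∫_{μ}^{∞} e^{−yψ(u)} e^{ru} e^{irw_A(u)} (1 + i w_A'(u)) du + (1/2) e^{iχ} · (1/(1 − e^{−2πt + 2πir})) ∫_{π/2}^{5π/2} e^{−yψ(u(w))} e^{−r u(w)} e^{irw} (−u'(w) + i) dw − (1/2) e^{−iχ} · (1/(1 − e^{−2πt + 2πir})) ∫_{π/2}^{5π/2} e^{−yψ(u(w))} e^{r u(w)} e^{irw} (u'(w) + i) dw, where in the dw-integrals u(w) is the inverse of w_B for w ∈ [π/2, 3π/2], and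 for w ∈ [3π/2, 5π/2] one sets u(w) := u_A(w − 2π) with u_A the inverse of w_A restricted to [μ_-, μ]. -/
open MeasureTheory Filter Topology

/-- `g(u) = (u cosh μ + sinh μ − μ cosh μ)/sinh u`. -/
noncomputable def gContour (μ u : ℝ) : ℝ :=
  (u * Real.cosh μ + Real.sinh μ - μ * Real.cosh μ) / Real.sinh u

/-- The branch `w_A(u) = arcsin(g(u))`. -/
noncomputable def wA (μ u : ℝ) : ℝ := Real.arcsin (gContour μ u)

/-- The branch `w_B(u) = π − arcsin(g(u))`. -/
noncomputable def wB (μ u : ℝ) : ℝ := Real.pi - Real.arcsin (gContour μ u)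

/-- `ψ(u) = cosh u · cos w_A(u) + w_A(u) · cosh μ` along the branch `w_A`. -/
noncomputable def ψA (μ u : ℝ) : ℝ :=
  Real.cosh u * Real.cos (wA μ u) + wA μ u * Real.cosh μ

/-- The numerator of the derivative of `gContour μ`. -/
noncomputable def gContourSlope (μ u : ℝ) : ℝ :=
  Real.cosh μ * Real.sinh u -
    (u * Real.cosh μ + Real.sinh μ - μ * Real.cosh μ) * Real.cosh u

lemma gContour_self {μ : ℝ} (hμ : 0 < μ) : gContour μ μ = 1 := by
  have := (Real.sinh_pos_iff.2 hμ).ne'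
  unfold gContour
  field_simp
  ring

lemma sinh_mul_gContour (μ : ℝ) {u : ℝ} (hu : 0 < u) :
    Real.sinh u * gContour μ u = u * Real.cosh μ + Real.sinh μ - μ * Real.cosh μ :=
  mul_div_cancel₀ _ (Real.sinh_pos_iff.2 hu).ne'

lemma hasStrictDerivAt_gContour (μ : ℝ) {u : ℝ} (hu : 0 < u) :
    HasStrictDerivAt (gContour μ) (gContourSlope μ u / Real.sinh u ^ 2) u := by
  have h := HasStrictDerivAt.div (((HasStrictDerivAt.mul_const (hasStrictDerivAt_id u)
    (Real.cosh μ)).add_const (Real.sinh μ)).sub_const (μ * Real.cosh μ))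
    (Real.hasStrictDerivAt_sinh u) (Real.sinh_pos_iff.2 hu).ne'
  refine h.congr_deriv ?_
  simp [gContourSlope]

lemma hasDerivAt_gContour (μ : ℝ) {u : ℝ} (hu : 0 < u) :
    HasDerivAt (gContour μ) (gContourSlope μ u / Real.sinh u ^ 2) u :=
  (hasStrictDerivAt_gContour μ hu).hasDerivAt

lemma sinh_le_mul_cosh {d : ℝ} (hd : 0 ≤ d) : Real.sinh d ≤ d * Real.cosh d := by
  have hder (x : ℝ) : HasDerivAt (fun x => x * Real.cosh x - Real.sinh x)
      (x * Real.sinh x) x :=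
    (((hasDerivAt_id x).mul (Real.hasDerivAt_cosh x)).sub
      (Real.hasDerivAt_sinh x)).congr_deriv (by simp)
  have hmono : MonotoneOn (fun x => x * Real.cosh x - Real.sinh x) (Set.Ici 0) := by
    refine monotoneOn_of_deriv_nonneg (convex_Ici 0) (by fun_prop) (by fun_prop) fun x hx => ?_
    rw [interior_Ici] at hx
    rw [(hder x).deriv]
    exact mul_nonneg (le_of_lt hx) (Real.sinh_nonneg_iff.2 (le_of_lt hx))
  have := hmono Set.self_mem_Ici (Set.mem_Ici.2 hd) hd
  simp at this
  linarith

lemma gContourSlope_eq (μ u : ℝ) :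
    gContourSlope μ u = Real.sinh (u - μ) - (u - μ) * Real.cosh (u - μ) -
      (u - μ) * (Real.sinh u * Real.sinh μ) := by
  rw [Real.sinh_sub, Real.cosh_sub, gContourSlope]
  ring

lemma gContourSlope_pos {μ u : ℝ} (hu : 0 < u) (huμ : u < μ) : 0 < gContourSlope μ u := by
  have h1 := sinh_le_mul_cosh (sub_nonneg.2 huμ.le)
  rw [← neg_sub u μ, Real.sinh_neg, Real.cosh_neg] at h1
  have h2 := mul_pos (sub_pos.2 huμ)
    (mul_pos (Real.sinh_pos_iff.2 hu) (Real.sinh_pos_iff.2 (hu.trans huμ)))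
  rw [gContourSlope_eq]
  linarith

lemma gContourSlope_neg {μ u : ℝ} (hμ : 0 < μ) (huμ : μ < u) : gContourSlope μ u < 0 := by
  have h1 := sinh_le_mul_cosh (sub_nonneg.2 huμ.le)
  have h2 := mul_pos (sub_pos.2 huμ)
    (mul_pos (Real.sinh_pos_iff.2 (hμ.trans huμ)) (Real.sinh_pos_iff.2 hμ))
  rw [gContourSlope_eq]
  linarith

lemma continuousOn_gContour (μ : ℝ) : ContinuousOn (gContour μ) (Set.Ioi 0) := fun _ hu =>
  (hasDerivAt_gContour μ hu).continuousAt.continuousWithinAt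

lemma strictMonoOn_gContour (μ : ℝ) : StrictMonoOn (gContour μ) (Set.Ioc 0 μ) := by
  refine strictMonoOn_of_deriv_pos (convex_Ioc 0 μ)
    ((continuousOn_gContour μ).mono Set.Ioc_subset_Ioi_self) fun u hu => ?_
  rw [interior_Ioc] at hu
  rw [(hasDerivAt_gContour μ hu.1).deriv]
  exact div_pos (gContourSlope_pos hu.1 hu.2) (pow_pos (Real.sinh_pos_iff.2 hu.1) 2)

lemma strictAntiOn_gContour {μ : ℝ} (hμ : 0 < μ) :
    StrictAntiOn (gContour μ) (Set.Ici μ) := by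
  refine strictAntiOn_of_deriv_neg (convex_Ici μ)
    ((continuousOn_gContour μ).mono (Set.Ici_subset_Ioi.2 hμ)) fun u hu => ?_
  rw [interior_Ici] at hu
  have hu0 : 0 < u := hμ.trans hu
  rw [(hasDerivAt_gContour μ hu0).deriv]
  exact div_neg_of_neg_of_pos (gContourSlope_neg hμ hu) (pow_pos (Real.sinh_pos_iff.2 hu0) 2)

lemma gContour_pos {μ u : ℝ} (hμ : 0 < μ) (hu : μ ≤ u) : 0 < gContour μ u := by
  refine div_pos ?_ (Real.sinh_pos_iff.2 (hμ.trans_le hu))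
  nlinarith [Real.sinh_pos_iff.2 hμ, Real.cosh_pos μ]

lemma gContour_lt_one {μ u : ℝ} (hμ : 0 < μ) (hu : μ < u) : gContour μ u < 1 := by
  simpa [gContour_self hμ] using
    strictAntiOn_gContour hμ Set.self_mem_Ici (Set.mem_Ici.2 hu.le) hu

lemma gContour_le_one {μ u : ℝ} (hμ : 0 < μ) (hu : μ ≤ u) : gContour μ u ≤ 1 := by
  rcases hu.eq_or_lt with rfl | hu
  · exact (gContour_self hμ).le
  · exact (gContour_lt_one hμ hu).le

lemma sq_div_four_le_sinh {u : ℝ} (hu : 0 ≤ u) : u ^ 2 / 4 ≤ Real.sinh u := by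
  rw [Real.sinh_eq]
  have h1 := Real.quadratic_le_exp_of_nonneg hu
  have h2 : Real.exp (-u) ≤ 1 := Real.exp_le_one_iff.2 (by linarith)
  linarith

lemma sq_div_four_le_cosh {u : ℝ} (hu : 0 ≤ u) : u ^ 2 / 4 ≤ Real.cosh u :=
  (sq_div_four_le_sinh hu).trans (Real.sinh_lt_cosh u).le

lemma tendsto_gContour_atTop {μ : ℝ} (hμ : 0 < μ) :
    Tendsto (gContour μ) atTop (𝓝 0) := by
  have hlim : Tendsto (fun u : ℝ => 4 * (Real.cosh μ + Real.sinh μ) / u) atTop (𝓝 0) :=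
    tendsto_const_nhds.div_atTop tendsto_id
  refine tendsto_of_tendsto_of_tendsto_of_le_of_le' tendsto_const_nhds hlim ?_ ?_
  · filter_upwards [eventually_ge_atTop μ] with u hu using (gContour_pos hμ hu).le
  · filter_upwards [eventually_ge_atTop 1] with u hu
    have hu0 : 0 < u := by linarith
    have hs := sq_div_four_le_sinh hu0.le
    have hsμ := Real.sinh_pos_iff.2 hμ
    have hcμ := Real.cosh_pos μ
    rw [gContour, div_le_div_iff₀ (Real.sinh_pos_iff.2 hu0) hu0]
    have h1 : u * Real.cosh μ + Real.sinh μ - μ * Real.cosh μ ≤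
        (Real.cosh μ + Real.sinh μ) * u := by nlinarith
    calc _ ≤ (Real.cosh μ + Real.sinh μ) * u * u := mul_le_mul_of_nonneg_right h1 hu0.le
      _ = 4 * (Real.cosh μ + Real.sinh μ) * (u ^ 2 / 4) := by ring
      _ ≤ _ := mul_le_mul_of_nonneg_left hs (by positivity)

lemma wA_self {μ : ℝ} (hμ : 0 < μ) : wA μ μ = Real.pi / 2 := by
  rw [wA, gContour_self hμ, Real.arcsin_one]

lemma continuousOn_wA (μ : ℝ) : ContinuousOn (wA μ) (Set.Ioi 0) :=
  Real.continuous_arcsin.comp_continuousOn (continuousOn_gContour μ)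

lemma hasDerivAt_wA (μ : ℝ) {u : ℝ} (hu : 0 < u) (h₁ : -1 < gContour μ u)
    (h₂ : gContour μ u < 1) :
    HasDerivAt (wA μ) (1 / √(1 - gContour μ u ^ 2) * (gContourSlope μ u / Real.sinh u ^ 2)) u :=
  (Real.hasDerivAt_arcsin h₁.ne' h₂.ne).comp u (hasDerivAt_gContour μ hu)

lemma hasDerivAt_wA_of_lt {μ u : ℝ} (hμ : 0 < μ) (hu : μ < u) :
    HasDerivAt (wA μ) (deriv (wA μ) u) u :=
  (hasDerivAt_wA μ (hμ.trans hu) (by linarith [gContour_pos hμ hu.le])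
    (gContour_lt_one hμ hu)).differentiableAt.hasDerivAt

lemma deriv_wA_nonpos {μ u : ℝ} (hμ : 0 < μ) (hu : μ < u) : deriv (wA μ) u ≤ 0 := by
  rw [(hasDerivAt_wA μ (hμ.trans hu) (by linarith [gContour_pos hμ hu.le])
    (gContour_lt_one hμ hu)).deriv]
  exact mul_nonpos_of_nonneg_of_nonpos (by positivity)
    (div_nonpos_of_nonpos_of_nonneg (gContourSlope_neg hμ hu).le (by positivity))

lemma tendsto_wA_atTop {μ : ℝ} (hμ : 0 < μ) : Tendsto (wA μ) atTop (𝓝 0) := by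
  have h := (Real.continuous_arcsin.tendsto 0).comp (tendsto_gContour_atTop hμ)
  rwa [Real.arcsin_zero] at h

lemma wA_nonneg {μ u : ℝ} (hμ : 0 < μ) (hu : μ ≤ u) : 0 ≤ wA μ u :=
  Real.arcsin_nonneg.2 (gContour_pos hμ hu).le

lemma integrableOn_deriv_wA {μ : ℝ} (hμ : 0 < μ) :
    IntegrableOn (deriv (wA μ)) (Set.Ioi μ) :=
  integrableOn_Ioi_deriv_of_nonpos
    (((continuousOn_wA μ) μ hμ).mono (Set.Ici_subset_Ioi.2 hμ))
    (fun _ hu => hasDerivAt_wA_of_lt hμ hu) (fun _ hu => deriv_wA_nonpos hμ hu)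
    (tendsto_wA_atTop hμ)

/-- The integrand of the K-Bessel function, as an entire function. -/
noncomputable def kBesselIntegrand (ν : ℂ) (y : ℝ) (z : ℂ) : ℂ :=
  Complex.exp (-(y : ℂ) * Complex.cosh z + ν * z)

lemma differentiable_kBesselIntegrand (ν : ℂ) (y : ℝ) :
    Differentiable ℂ (kBesselIntegrand ν y) := by
  unfold kBesselIntegrand
  fun_prop

lemma continuous_kBesselIntegrand (ν : ℂ) (y : ℝ) : Continuous (kBesselIntegrand ν y) :=
  (differentiable_kBesselIntegrand ν y).continuous

lemma exists_primitive_kBesselIntegrand (ν : ℂ) (y : ℝ) :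
    ∃ G : ℂ → ℂ, ∀ z, HasDerivAt G (kBesselIntegrand ν y z) z := by
  obtain ⟨G, hG⟩ := (differentiable_kBesselIntegrand ν y).isExactOn_univ
  exact ⟨G, fun z => hG z (Set.mem_univ z)⟩

lemma kBesselIntegrand_add_two_pi_I (ν : ℂ) (y : ℝ) (z : ℂ) :
    kBesselIntegrand ν y (z + 2 * Real.pi * Complex.I) =
      Complex.exp (2 * Real.pi * Complex.I * ν) * kBesselIntegrand ν y z := by
  have : Complex.cosh (z + 2 * Real.pi * Complex.I) = Complex.cosh z := by
    rw [Complex.cosh_add]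
    simp [Complex.cosh_mul_I, Complex.sinh_mul_I]
  rw [kBesselIntegrand, kBesselIntegrand, this, ← Complex.exp_add]
  ring_nf

lemma primitive_add_two_pi_I {ν : ℂ} {y : ℝ} {G : ℂ → ℂ}
    (hG : ∀ z, HasDerivAt G (kBesselIntegrand ν y z) z) (z₀ z₁ : ℂ) :
    G (z₁ + 2 * Real.pi * Complex.I) - G (z₀ + 2 * Real.pi * Complex.I) =
      Complex.exp (2 * Real.pi * Complex.I * ν) * (G z₁ - G z₀) := by
  have hder (z : ℂ) : HasDerivAt (fun z => G (z + 2 * Real.pi * Complex.I) -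
      Complex.exp (2 * Real.pi * Complex.I * ν) * G z) 0 z := by
    refine (((hG _).comp_add_const z _).sub ((hG z).const_mul _)).congr_deriv ?_
    rw [kBesselIntegrand_add_two_pi_I, sub_self]
  have := is_const_of_deriv_eq_zero (fun z => (hder z).differentiableAt)
    (fun z => (hder z).deriv) z₁ z₀
  linear_combination this

lemma cosh_sign_mul_add {σ : ℝ} (hσ : σ = 1 ∨ σ = -1) (u w : ℝ) :
    Complex.cosh ((σ * u : ℂ) + w * Complex.I) =
      (Real.cosh u * Real.cos w : ℝ) + (σ * (Real.sinh u * Real.sin w) : ℝ) * Complex.I := by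
  rw [Complex.cosh_add, Complex.cosh_mul_I, Complex.sinh_mul_I]
  rcases hσ with rfl | rfl
  · push_cast
    ring_nf
  · push_cast
    simp only [neg_mul, one_mul, Complex.cosh_neg, Complex.sinh_neg]
    ring_nf

lemma norm_kBesselIntegrand {σ : ℝ} (hσ : σ = 1 ∨ σ = -1) (r t y u w : ℝ) :
    ‖kBesselIntegrand (r + t * Complex.I) y ((σ * u : ℂ) + w * Complex.I)‖ =
      Real.exp (-y * (Real.cosh u * Real.cos w) + σ * (r * u) - t * w) := by
  rw [kBesselIntegrand, cosh_sign_mul_add hσ, Complex.norm_exp]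
  congr 1
  simp [Complex.cos_ofReal_re]
  ring

lemma exists_norm_kBesselIntegrand_le {σ : ℝ} (hσ : σ = 1 ∨ σ = -1) (r : ℝ) {t y : ℝ}
    (ht : 0 ≤ t) (hy : 0 < y) :
    ∃ N : ℝ, 0 ≤ N ∧ ∀ u, N ≤ u → ∀ w, 0 ≤ w → w ≤ Real.pi / 3 →
      ‖kBesselIntegrand (r + t * Complex.I) y ((σ * u : ℂ) + w * Complex.I)‖ ≤
        Real.exp (-1 * u) := by
  refine ⟨8 * (|r| + 1) / y, by positivity, fun u hu w hw hw' => ?_⟩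
  have hu0 : 0 ≤ u := le_trans (by positivity) hu
  rw [norm_kBesselIntegrand hσ, Real.exp_le_exp]
  have hcos : 1 / 2 ≤ Real.cos w := by
    rw [← Real.cos_pi_div_three]
    exact Real.cos_le_cos_of_nonneg_of_le_pi hw (by linarith [Real.pi_pos]) hw'
  have h1 : u ^ 2 / 8 ≤ Real.cosh u * Real.cos w := by
    have := mul_le_mul (sq_div_four_le_cosh hu0) hcos (by norm_num) (Real.cosh_pos u).le
    linarith
  have h2 : σ * (r * u) ≤ |r| * u := by
    rcases hσ with rfl | rfl
    · nlinarith [le_abs_self r]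
    · nlinarith [neg_abs_le r]
  have h3 : (|r| + 1) * u ≤ y * (u ^ 2 / 8) := by
    rw [div_le_iff₀ hy] at hu
    nlinarith
  nlinarith [mul_nonneg ht hw, mul_le_mul_of_nonneg_left h1 hy.le]

lemma integrableOn_Ioi_of_norm_le_exp {f : ℝ → ℂ} {a : ℝ}
    (hf : ContinuousOn f (Set.Ici a)) (hb : ∀ᶠ u in atTop, ‖f u‖ ≤ Real.exp (-1 * u)) :
    IntegrableOn f (Set.Ioi a) := by
  have h : IntegrableOn (fun u => ‖f u‖) (Set.Ioi a) := by
    refine integrable_of_isBigO_exp_neg one_pos hf.norm (Asymptotics.IsBigO.of_bound 1 ?_)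
    filter_upwards [hb] with u hu
    simpa using hu
  exact (integrable_norm_iff ((hf.mono Set.Ioi_subset_Ici_self).aestronglyMeasurable
    measurableSet_Ioi)).1 h

/-- A function that is continuous on a half-line and eventually bounded by `exp (-u)` is bounded there. -/
lemma exists_norm_le_of_norm_le_exp {f : ℝ → ℂ} {a : ℝ}
    (hf : ContinuousOn f (Set.Ici a)) (hb : ∀ᶠ u in atTop, ‖f u‖ ≤ Real.exp (-1 * u)) :
    ∃ C, ∀ u ∈ Set.Ici a, ‖f u‖ ≤ C := by
  obtain ⟨N, hN⟩ := eventually_atTop.1 hb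
  obtain ⟨C, hC⟩ := isCompact_Icc.exists_bound_of_continuousOn
    (hf.mono (Set.Icc_subset_Ici_self : Set.Icc a N ⊆ _))
  refine ⟨max C (Real.exp (-1 * N)), fun u hu => ?_⟩
  rcases le_total u N with h | h
  · exact (hC u ⟨hu, h⟩).trans (le_max_left _ _)
  · exact (hN u h).trans ((Real.exp_le_exp.2 (by linarith)).trans (le_max_right _ _))

lemma hasDerivAt_primitive_comp {ν : ℂ} {y : ℝ} {G : ℂ → ℂ}
    (hG : ∀ z, HasDerivAt G (kBesselIntegrand ν y z) z) {γ : ℝ → ℂ} {γ' : ℂ} {x : ℝ}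
    (hγ : HasDerivAt γ γ' x) :
    HasDerivAt (fun x => G (γ x)) (kBesselIntegrand ν y (γ x) * γ') x := by
  exact HasDerivAt.comp_of_eq x (hG (γ x)) hγ rfl

lemma eventually_norm_kBesselIntegrand_real_le {σ : ℝ} (hσ : σ = 1 ∨ σ = -1) (r : ℝ) {t y : ℝ}
    (ht : 0 ≤ t) (hy : 0 < y) :
    ∀ᶠ u : ℝ in atTop, ‖kBesselIntegrand (r + t * Complex.I) y (σ * u)‖ ≤
      Real.exp (-1 * u) := by
  obtain ⟨N, -, hN⟩ := exists_norm_kBesselIntegrand_le hσ r ht hy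
  filter_upwards [eventually_ge_atTop N] with u hu
  simpa using hN u hu 0 le_rfl (by positivity)

lemma integrableOn_kBesselIntegrand_real {σ : ℝ} (hσ : σ = 1 ∨ σ = -1) (r : ℝ) {t y : ℝ}
    (ht : 0 ≤ t) (hy : 0 < y) :
    IntegrableOn (fun u : ℝ => kBesselIntegrand (r + t * Complex.I) y (σ * u)) (Set.Ioi 0) :=
  integrableOn_Ioi_of_norm_le_exp
    ((continuous_kBesselIntegrand _ y).comp (by fun_prop)).continuousOn
    (eventually_norm_kBesselIntegrand_real_le hσ r ht hy)

lemma exists_tendsto_primitive {σ : ℝ} (hσ : σ = 1 ∨ σ = -1) (r : ℝ) {t y : ℝ}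
    (ht : 0 ≤ t) (hy : 0 < y) {G : ℂ → ℂ}
    (hG : ∀ z, HasDerivAt G (kBesselIntegrand (r + t * Complex.I) y z) z) :
    ∃ L, Tendsto (fun u : ℝ => G (σ * u)) atTop (𝓝 L) := by
  refine ⟨_, tendsto_limUnder_of_hasDerivAt_of_integrableOn_Ioi (a := 0) (fun u _ => ?_)
    ((integrableOn_kBesselIntegrand_real hσ r ht hy).mul_const (σ : ℂ))⟩
  refine hasDerivAt_primitive_comp hG ?_
  simpa using ((hasDerivAt_id u).ofReal_comp.const_mul (σ : ℂ))

lemma integral_kBesselIntegrand_real (r : ℝ) {t y : ℝ} (ht : 0 ≤ t) (hy : 0 < y) {G : ℂ → ℂ}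
    (hG : ∀ z, HasDerivAt G (kBesselIntegrand (r + t * Complex.I) y z) z) {L L' : ℂ}
    (hL : Tendsto (fun u : ℝ => G (((1 : ℝ) : ℂ) * u)) atTop (𝓝 L))
    (hL' : Tendsto (fun u : ℝ => G (((-1 : ℝ) : ℂ) * u)) atTop (𝓝 L')) :
    ∫ x : ℝ, kBesselIntegrand (r + t * Complex.I) y x = L - L' := by
  have hcont : Continuous fun x : ℝ => kBesselIntegrand (r + t * Complex.I) y x :=
    (continuous_kBesselIntegrand _ y).comp Complex.continuous_ofReal
  refine integral_of_hasDerivAt_of_tendsto (f := fun x : ℝ => G x) (fun x => ?_) ?_ ?_ ?_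
  · simpa using hasDerivAt_primitive_comp hG (hasDerivAt_id x).ofReal_comp
  · rw [← integrableOn_univ, ← Set.Iic_union_Ioi (a := (0 : ℝ)), integrableOn_union]
    constructor
    · have h := integrableOn_kBesselIntegrand_real (σ := -1) (.inr rfl) r ht hy
      rw [← integrableOn_Ici_iff_integrableOn_Ioi] at h
      simpa using h.comp_neg
    · simpa using integrableOn_kBesselIntegrand_real (σ := 1) (.inl rfl) r ht hy
  · simpa [Function.comp_def] using hL'.comp tendsto_neg_atBot_atTop
  · simpa using hL

lemma tendsto_primitive_wA {σ : ℝ} (hσ : σ = 1 ∨ σ = -1) (r : ℝ) {t y μ : ℝ} (hμ : 0 < μ)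
    (ht : 0 ≤ t) (hy : 0 < y) {G : ℂ → ℂ}
    (hG : ∀ z, HasDerivAt G (kBesselIntegrand (r + t * Complex.I) y z) z) {L : ℂ}
    (hL : Tendsto (fun u : ℝ => G (σ * u)) atTop (𝓝 L)) :
    Tendsto (fun u : ℝ => G (σ * u + wA μ u * Complex.I)) atTop (𝓝 L) := by
  obtain ⟨N, hN0, hN⟩ := exists_norm_kBesselIntegrand_le hσ r ht hy
  have hw : ∀ᶠ u in atTop, wA μ u < Real.pi / 3 :=
    (tendsto_wA_atTop hμ).eventually_lt_const (by positivity)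
  have hdiff : Tendsto (fun u : ℝ => G (σ * u + wA μ u * Complex.I) - G (σ * u)) atTop
      (𝓝 0) := by
    refine squeeze_zero_norm' (a := fun u => |wA μ u|) ?_ ?_
    · filter_upwards [hw, eventually_ge_atTop N, eventually_ge_atTop μ] with u hwu huN huμ
      have h := (convex_Icc 0 (wA μ u)).norm_image_sub_le_of_norm_hasDerivWithin_le
        (f := fun s : ℝ => G (σ * u + s * Complex.I))
        (f' := fun s : ℝ =>
          kBesselIntegrand (r + t * Complex.I) y (σ * u + s * Complex.I) * Complex.I)
        (C := 1) (x := 0) (y := wA μ u) (fun s _ => ?_) (fun s hs => ?_)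
        ⟨le_rfl, wA_nonneg hμ huμ⟩ ⟨wA_nonneg hμ huμ, le_rfl⟩
      · simpa using h
      · refine (hasDerivAt_primitive_comp hG ?_).hasDerivWithinAt
        simpa using ((hasDerivAt_id s).ofReal_comp.mul_const Complex.I).const_add (σ * u : ℂ)
      · rw [norm_mul, Complex.norm_I, mul_one]
        refine (hN u huN s hs.1 (hs.2.trans hwu.le)).trans (Real.exp_le_one_iff.2 ?_)
        linarith
    · simpa using (tendsto_wA_atTop hμ).abs
  simpa using hdiff.add hL

lemma integral_wA {σ : ℝ} (hσ : σ = 1 ∨ σ = -1) (r : ℝ) {t y μ : ℝ} (hμ : 0 < μ)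
    (ht : 0 ≤ t) (hy : 0 < y) {G : ℂ → ℂ}
    (hG : ∀ z, HasDerivAt G (kBesselIntegrand (r + t * Complex.I) y z) z) {L : ℂ}
    (hL : Tendsto (fun u : ℝ => G (σ * u)) atTop (𝓝 L)) :
    ∫ u in Set.Ioi μ, kBesselIntegrand (r + t * Complex.I) y (σ * u + wA μ u * Complex.I) *
      (σ + deriv (wA μ) u * Complex.I) =
      L - G (σ * μ + (Real.pi / 2 : ℝ) * Complex.I) := by
  have hwc : ContinuousOn (wA μ) (Set.Ici μ) :=
    (continuousOn_wA μ).mono (Set.Ici_subset_Ioi.2 hμ)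
  have hγ : ContinuousOn (fun u : ℝ => (σ * u + wA μ u * Complex.I : ℂ)) (Set.Ici μ) :=
    (by fun_prop : Continuous fun u : ℝ => (σ * u : ℂ)).continuousOn.add
      ((Complex.continuous_ofReal.comp_continuousOn hwc).mul continuousOn_const)
  have hFγ : ContinuousOn (fun u : ℝ => kBesselIntegrand (r + t * Complex.I) y
      (σ * u + wA μ u * Complex.I)) (Set.Ici μ) :=
    (continuous_kBesselIntegrand _ y).comp_continuousOn hγ
  have hb : ∀ᶠ u : ℝ in atTop, ‖kBesselIntegrand (r + t * Complex.I) y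
      (σ * u + wA μ u * Complex.I)‖ ≤ Real.exp (-1 * u) := by
    obtain ⟨N, -, hN⟩ := exists_norm_kBesselIntegrand_le hσ r ht hy
    filter_upwards [(tendsto_wA_atTop hμ).eventually_lt_const (by positivity : 0 < Real.pi / 3),
      eventually_ge_atTop N, eventually_ge_atTop μ] with u hwu huN huμ
    exact hN u huN _ (wA_nonneg hμ huμ) hwu.le
  have hGc : Continuous G := continuous_iff_continuousAt.2 fun z => (hG z).continuousAt
  rw [← wA_self hμ]
  refine integral_Ioi_of_hasDerivAt_of_tendsto
    (f := fun u : ℝ => G (σ * u + wA μ u * Complex.I))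
    ((hGc.comp_continuousOn hγ) μ Set.self_mem_Ici) (fun u hu => ?_) ?_
    (tendsto_primitive_wA hσ r hμ ht hy hG hL)
  · refine hasDerivAt_primitive_comp hG ?_
    refine HasDerivAt.add ?_ ((hasDerivAt_wA_of_lt hμ hu).ofReal_comp.mul_const _)
    simpa using ((hasDerivAt_id u).ofReal_comp.const_mul (σ : ℂ))
  · simp_rw [mul_add]
    refine ((integrableOn_Ioi_of_norm_le_exp hFγ hb).mul_const (σ : ℂ)).add ?_
    obtain ⟨C, hC⟩ := exists_norm_le_of_norm_le_exp hFγ hb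
    refine Integrable.bdd_mul (c := C) ((integrableOn_deriv_wA hμ).ofReal.mul_const _)
      ((hFγ.mono Set.Ioi_subset_Ici_self).aestronglyMeasurable measurableSet_Ioi) ?_
    exact (ae_restrict_mem measurableSet_Ioi).mono fun u hu => hC u (Set.Ioi_subset_Ici_self hu)

section ClosedContour

variable {μ μm : ℝ} {U : ℝ → ℝ}

lemma gContour_eq_sin_of_arcsin_eq (hμm : 0 < μm) (hμmμ : μm < μ) (hgμm : gContour μ μm = -1)
    {u x : ℝ} (hu : u ∈ Set.Icc μm μ) (h : Real.arcsin (gContour μ u) = x) :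
    gContour μ u = Real.sin x := by
  have hmono := (strictMonoOn_gContour μ).monotoneOn
  have hm : μm ∈ Set.Ioc 0 μ := ⟨hμm, hμmμ.le⟩
  have hu' : u ∈ Set.Ioc 0 μ := ⟨hμm.trans_le hu.1, hu.2⟩
  have hμ : μ ∈ Set.Ioc 0 μ := ⟨hμm.trans hμmμ, le_rfl⟩
  rw [← h, Real.sin_arcsin]
  · exact hgμm ▸ hmono hm hu' hu.1
  · exact gContour_self hμ.1 ▸ hmono hu' hμ hu.2

/-- On the closed contour, `U` inverts `gContour μ` up to the sine. -/
lemma gContour_closedContour (hμm : 0 < μm) (hμmμ : μm < μ) (hgμm : gContour μ μm = -1)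
    (hU1 : ∀ w ∈ Set.Icc (Real.pi / 2) (3 * Real.pi / 2),
      U w ∈ Set.Icc μm μ ∧ wB μ (U w) = w)
    (hU2 : ∀ w ∈ Set.Icc (3 * Real.pi / 2) (5 * Real.pi / 2),
      U w ∈ Set.Icc μm μ ∧ wA μ (U w) = w - 2 * Real.pi)
    {w : ℝ} (hw : w ∈ Set.Icc (Real.pi / 2) (5 * Real.pi / 2)) :
    U w ∈ Set.Icc μm μ ∧ gContour μ (U w) = Real.sin w := by
  rcases le_total w (3 * Real.pi / 2) with h | h
  · obtain ⟨hmem, hB⟩ := hU1 w ⟨hw.1, h⟩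
    refine ⟨hmem, ?_⟩
    rw [wB] at hB
    rw [gContour_eq_sin_of_arcsin_eq hμm hμmμ hgμm hmem (x := Real.pi - w) (by linarith),
      Real.sin_pi_sub]
  · obtain ⟨hmem, hA⟩ := hU2 w ⟨h, hw.2⟩
    refine ⟨hmem, ?_⟩
    rw [gContour_eq_sin_of_arcsin_eq hμm hμmμ hgμm hmem hA, Real.sin_sub_two_pi]

lemma eq_of_gContour_eq (hμm : 0 < μm) {u v : ℝ} (hu : u ∈ Set.Icc μm μ)
    (hv : v ∈ Set.Icc μm μ) (h : gContour μ u = gContour μ v) : u = v :=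
  (strictMonoOn_gContour μ).injOn ⟨hμm.trans_le hu.1, hu.2⟩ ⟨hμm.trans_le hv.1, hv.2⟩ h

lemma continuousOn_of_gContour_eq_sin (hμm : 0 < μm) {s : Set ℝ}
    (hU : ∀ w ∈ s, U w ∈ Set.Icc μm μ ∧ gContour μ (U w) = Real.sin w) :
    ContinuousOn U s := by
  have hemb : IsClosedEmbedding fun u : Set.Icc μm μ => gContour μ u := by
    refine Continuous.isClosedEmbedding ?_ fun u v h =>
      Subtype.ext (eq_of_gContour_eq hμm u.2 v.2 h)
    exact ((continuousOn_gContour μ).mono fun u hu => hμm.trans_le hu.1).domRestrict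
  rw [continuousOn_iff_continuous_domRestrict]
  have hc : Continuous fun w : s => (⟨U w, (hU w w.2).1⟩ : Set.Icc μm μ) := by
    rw [hemb.isInducing.continuous_iff]
    have : ((fun u : Set.Icc μm μ => gContour μ u) ∘ fun w : s =>
        (⟨U w, (hU w w.2).1⟩ : Set.Icc μm μ)) = fun w : s => Real.sin w :=
      funext fun w => (hU w w.2).2
    rw [this]
    fun_prop
  exact continuous_subtype_val.comp hc

lemma hasDerivAt_of_gContour_eq_sin (hμm : 0 < μm) {a b : ℝ}
    (hU : ∀ w ∈ Set.Icc a b, U w ∈ Set.Icc μm μ ∧ gContour μ (U w) = Real.sin w)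
    {w : ℝ} (hw : w ∈ Set.Ioo a b) (hcos : Real.cos w ≠ 0) :
    HasDerivAt U (deriv U w) w ∧ 0 ≤ Real.cos w * deriv U w := by
  have hnhds : Set.Icc a b ∈ 𝓝 w := Icc_mem_nhds hw.1 hw.2
  obtain ⟨hmem, hsin⟩ := hU w (Set.Ioo_subset_Icc_self hw)
  have hU0 : 0 < U w := hμm.trans_le hmem.1
  have hUμ : U w < μ := by
    refine hmem.2.lt_of_ne fun h => hcos ?_
    rw [h, gContour_self (h ▸ hU0)] at hsin
    have := Real.sin_sq_add_cos_sq w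
    rw [← hsin] at this
    exact pow_eq_zero_iff two_ne_zero |>.1 (by linarith)
  have hslope : 0 < gContourSlope μ (U w) / Real.sinh (U w) ^ 2 :=
    div_pos (gContourSlope_pos hU0 hUμ) (pow_pos (Real.sinh_pos_iff.2 hU0) 2)
  have hg := hasStrictDerivAt_gContour μ hU0
  have hinv := hg.to_localInverse hslope.ne'
  have hcont : ContinuousAt U w := (continuousOn_of_gContour_eq_sin hμm hU).continuousAt hnhds
  have hleft := hcont.eventually
    (hg.hasStrictFDerivAt_equiv hslope.ne').eventually_left_inverse
  rw [hsin] at hinv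
  have hderiv := (hinv.hasDerivAt.comp w (Real.hasDerivAt_sin w)).congr_of_eventuallyEq
    (f₁ := U) (by
      filter_upwards [hleft, hnhds] with x hx hxI
      rw [Function.comp_apply, ← (hU x hxI).2]
      exact hx.symm)
  refine ⟨hderiv.differentiableAt.hasDerivAt, ?_⟩
  rw [hderiv.deriv, mul_left_comm]
  exact mul_nonneg (inv_nonneg.2 hslope.le) (mul_self_nonneg _)

lemma cos_pos_of_three_pi_div_two_lt {w : ℝ} (h₁ : 3 * Real.pi / 2 < w)
    (h₂ : w < 5 * Real.pi / 2) : 0 < Real.cos w := by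
  rw [← Real.cos_sub_two_pi]
  exact Real.cos_pos_of_mem_Ioo ⟨by linarith, by linarith⟩

lemma cos_neg_of_lt_three_pi_div_two {w : ℝ} (h₁ : Real.pi / 2 < w)
    (h₂ : w < 3 * Real.pi / 2) : Real.cos w < 0 :=
  Real.cos_neg_of_pi_div_two_lt_of_lt h₁ (by linarith)

lemma intervalIntegrable_deriv_of_gContour_eq_sin (hμm : 0 < μm)
    (hU : ∀ w ∈ Set.Icc (Real.pi / 2) (5 * Real.pi / 2),
      U w ∈ Set.Icc μm μ ∧ gContour μ (U w) = Real.sin w) :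
    IntervalIntegrable (deriv U) volume (Real.pi / 2) (5 * Real.pi / 2) := by
  have hπ := Real.pi_pos
  have hcont := continuousOn_of_gContour_eq_sin hμm hU
  have h1 : Real.pi / 2 ≤ 3 * Real.pi / 2 := by linarith
  have h2 : 3 * Real.pi / 2 ≤ 5 * Real.pi / 2 := by linarith
  refine IntervalIntegrable.trans (b := 3 * Real.pi / 2) ?_ ?_
  · suffices IntervalIntegrable (fun w => -deriv U w) volume (Real.pi / 2)
        (3 * Real.pi / 2) by simpa [Pi.neg_def] using this.neg
    apply intervalIntegral.intervalIntegrable_deriv_of_nonneg (g := fun w => -U w)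
    · rw [Set.uIcc_of_le h1]
      exact (hcont.mono (Set.Icc_subset_Icc_right h2)).neg
    · rw [min_eq_left h1, max_eq_right h1]
      exact fun w hw => (hasDerivAt_of_gContour_eq_sin hμm hU ⟨hw.1, hw.2.trans_le h2⟩
        (cos_neg_of_lt_three_pi_div_two hw.1 hw.2).ne).1.neg
    · rw [min_eq_left h1, max_eq_right h1]
      intro w hw
      have hc := cos_neg_of_lt_three_pi_div_two hw.1 hw.2
      have := (hasDerivAt_of_gContour_eq_sin hμm hU ⟨hw.1, hw.2.trans_le h2⟩ hc.ne).2
      nlinarith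
  · apply intervalIntegral.intervalIntegrable_deriv_of_nonneg (g := U)
    · rw [Set.uIcc_of_le h2]
      exact hcont.mono (Set.Icc_subset_Icc_left h1)
    · rw [min_eq_left h2, max_eq_right h2]
      exact fun w hw => (hasDerivAt_of_gContour_eq_sin hμm hU ⟨h1.trans_lt hw.1, hw.2⟩
        (cos_pos_of_three_pi_div_two_lt hw.1 hw.2).ne').1
    · rw [min_eq_left h2, max_eq_right h2]
      intro w hw
      have hc := cos_pos_of_three_pi_div_two_lt hw.1 hw.2
      exact nonneg_of_mul_nonneg_right
        (hasDerivAt_of_gContour_eq_sin hμm hU ⟨h1.trans_lt hw.1, hw.2⟩ hc.ne').2 hc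

lemma integral_closedContour (σ : ℝ) (ν : ℂ) (y : ℝ) (hμm : 0 < μm) (hμmμ : μm < μ)
    (hU : ∀ w ∈ Set.Icc (Real.pi / 2) (5 * Real.pi / 2),
      U w ∈ Set.Icc μm μ ∧ gContour μ (U w) = Real.sin w) {G : ℂ → ℂ}
    (hG : ∀ z, HasDerivAt G (kBesselIntegrand ν y z) z) :
    ∫ w in (Real.pi / 2)..(5 * Real.pi / 2),
      kBesselIntegrand ν y (σ * U w + w * Complex.I) * (σ * deriv U w + Complex.I) =
      G (σ * μ + (Real.pi / 2 : ℝ) * Complex.I + 2 * Real.pi * Complex.I) -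
        G (σ * μ + (Real.pi / 2 : ℝ) * Complex.I) := by
  have hπ := Real.pi_pos
  have hle : Real.pi / 2 ≤ 5 * Real.pi / 2 := by linarith
  have hcont := continuousOn_of_gContour_eq_sin hμm hU
  have hμ : μ ∈ Set.Icc μm μ := ⟨hμmμ.le, le_rfl⟩
  have hg := gContour_self (hμm.trans hμmμ)
  have hUa : U (Real.pi / 2) = μ := by
    obtain ⟨hmem, h⟩ := hU _ (Set.left_mem_Icc.2 hle)
    exact eq_of_gContour_eq hμm hmem hμ (by rw [h, hg, Real.sin_pi_div_two])
  have hUb : U (5 * Real.pi / 2) = μ := by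
    obtain ⟨hmem, h⟩ := hU _ (Set.right_mem_Icc.2 hle)
    refine eq_of_gContour_eq hμm hmem hμ ?_
    rw [h, hg, ← Real.sin_sub_two_pi, ← Real.sin_pi_div_two]
    ring_nf
  have hγ : ContinuousOn (fun w : ℝ => (σ * U w + w * Complex.I : ℂ))
      (Set.Icc (Real.pi / 2) (5 * Real.pi / 2)) :=
    (continuousOn_const.mul (Complex.continuous_ofReal.comp_continuousOn hcont)).add
      (by fun_prop)
  have hGc : Continuous G := continuous_iff_continuousAt.2 fun z => (hG z).continuousAt
  have hint := intervalIntegrable_deriv_of_gContour_eq_sin hμm hU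
  rw [integral_eq_of_hasDerivAt_off_countable_of_le
    (fun w : ℝ => G (σ * U w + w * Complex.I)) _ hle
    (Set.countable_singleton (3 * Real.pi / 2)) (hGc.comp_continuousOn hγ) ?_ ?_]
  · simp only [hUa, hUb]
    congr 2
    push_cast
    ring
  · rintro w ⟨hw, hne⟩
    have hcos : Real.cos w ≠ 0 := by
      rcases lt_or_gt_of_ne hne with h | h
      · exact (cos_neg_of_lt_three_pi_div_two hw.1 h).ne
      · exact (cos_pos_of_three_pi_div_two_lt h hw.2).ne'
    refine hasDerivAt_primitive_comp hG ?_
    refine HasDerivAt.add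
      ((hasDerivAt_of_gContour_eq_sin hμm hU hw hcos).1.ofReal_comp.const_mul _) ?_
    simpa using (hasDerivAt_id w).ofReal_comp.mul_const Complex.I
  · refine IntervalIntegrable.continuousOn_mul (.add ?_ intervalIntegrable_const) ?_
    · exact IntervalIntegrable.const_mul ⟨hint.1.ofReal, hint.2.ofReal⟩ _
    · rw [Set.uIcc_of_le hle]
      exact (continuous_kBesselIntegrand ν y).comp_continuousOn hγ

end ClosedContour

lemma kBesselIntegrand_contour {σ : ℝ} (hσ : σ = 1 ∨ σ = -1) (μ y r : ℝ) {u w : ℝ}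
    (h : Real.sinh u * Real.sin w = u * Real.cosh μ + Real.sinh μ - μ * Real.cosh μ) :
    kBesselIntegrand (r + (y * Real.cosh μ : ℝ) * Complex.I) y (σ * u + w * Complex.I) =
      Complex.exp (-(σ * (Complex.I * (y * (Real.sinh μ - μ * Real.cosh μ) : ℝ)))) *
      (Complex.exp (-(y : ℂ) * (Real.cosh u * Real.cos w + w * Real.cosh μ : ℝ)) *
        Complex.exp (σ * r * u) * Complex.exp (Complex.I * r * w)) := by
  rw [kBesselIntegrand, cosh_sign_mul_add hσ, h, ← Complex.exp_add, ← Complex.exp_add,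
    ← Complex.exp_add]
  congr 1
  simp only [Complex.ofReal_add, Complex.ofReal_mul, Complex.ofReal_sub]
  linear_combination (y * Complex.ofReal (Real.cosh μ) * w) * Complex.I_mul_I

lemma exp_mul_integral_wA {σ : ℝ} (hσ : σ = 1 ∨ σ = -1) (r : ℝ) {y μ : ℝ} (hμ : 0 < μ)
    (hy : 0 < y) {G : ℂ → ℂ}
    (hG : ∀ z, HasDerivAt G
      (kBesselIntegrand (r + (y * Real.cosh μ : ℝ) * Complex.I) y z) z) {L : ℂ}
    (hL : Tendsto (fun u : ℝ => G (σ * u)) atTop (𝓝 L)) :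
    Complex.exp (-(σ * (Complex.I * (y * (Real.sinh μ - μ * Real.cosh μ) : ℝ)))) *
      (∫ u in Set.Ioi μ, Complex.exp (-(y : ℂ) * (ψA μ u : ℝ)) *
        Complex.exp (σ * r * u) * Complex.exp (Complex.I * r * wA μ u) *
        (1 + σ * (Complex.I * deriv (wA μ) u))) =
      σ * (L - G (σ * μ + (Real.pi / 2 : ℝ) * Complex.I)) := by
  rw [← integral_wA hσ r hμ (by positivity) hy hG hL, ← integral_const_mul,
    ← integral_const_mul]
  refine setIntegral_congr_fun measurableSet_Ioi fun u (hu : μ < u) => ?_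
  have hσ2 : (σ : ℂ) * σ = 1 := by rcases hσ with rfl | rfl <;> norm_num
  rw [kBesselIntegrand_contour hσ μ y r, ψA]
  · linear_combination (-Complex.exp (-(σ * (Complex.I *
      (y * (Real.sinh μ - μ * Real.cosh μ) : ℝ)))) * (Complex.exp (-(y : ℂ) *
      (Real.cosh u * Real.cos (wA μ u) + wA μ u * Real.cosh μ : ℝ)) *
      Complex.exp (σ * r * u) * Complex.exp (Complex.I * r * wA μ u))) * hσ2
  · rw [wA, Real.sin_arcsin (by linarith [gContour_pos hμ hu.le])
      (gContour_le_one hμ hu.le), sinh_mul_gContour μ (hμ.trans hu)]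

lemma exp_mul_integral_closedContour {σ : ℝ} (hσ : σ = 1 ∨ σ = -1) (r y : ℝ) {μ μm : ℝ}
    {U : ℝ → ℝ} (hμm : 0 < μm) (hμmμ : μm < μ)
    (hU : ∀ w ∈ Set.Icc (Real.pi / 2) (5 * Real.pi / 2),
      U w ∈ Set.Icc μm μ ∧ gContour μ (U w) = Real.sin w) {G : ℂ → ℂ}
    (hG : ∀ z, HasDerivAt G
      (kBesselIntegrand (r + (y * Real.cosh μ : ℝ) * Complex.I) y z) z) :
    Complex.exp (-(σ * (Complex.I * (y * (Real.sinh μ - μ * Real.cosh μ) : ℝ)))) *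
      (∫ w in (Real.pi / 2)..(5 * Real.pi / 2),
        Complex.exp (-(y : ℂ) * (Real.cosh (U w) * Real.cos w + w * Real.cosh μ : ℝ)) *
        Complex.exp (σ * r * U w) * Complex.exp (Complex.I * r * w) *
        (σ * deriv U w + Complex.I)) =
      G (σ * μ + (Real.pi / 2 : ℝ) * Complex.I + 2 * Real.pi * Complex.I) -
        G (σ * μ + (Real.pi / 2 : ℝ) * Complex.I) := by
  rw [← integral_closedContour σ _ y hμm hμmμ hU hG, ← intervalIntegral.integral_const_mul]
  refine intervalIntegral.integral_congr fun w hw => ?_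
  rw [Set.uIcc_of_le (by linarith [Real.pi_pos])] at hw
  rw [kBesselIntegrand_contour hσ μ y r]
  · ring
  · rw [← (hU w hw).2, sinh_mul_gContour μ (hμm.trans_le (hU w hw).1.1)]

theorem kbessel_integral_representation_Lplus (μ y r μm : ℝ) (U : ℝ → ℝ)
    (hμ : 0 < μ) (hy : 0 < y)
    (hμm : 0 < μm) (hμmμ : μm < μ) (hgμm : gContour μ μm = -1)
    (hμm_uniq : ∀ u ∈ Set.Ioo (0 : ℝ) μ, gContour μ u = -1 → u = μm)
    (hU1 : ∀ w ∈ Set.Icc (Real.pi / 2) (3 * Real.pi / 2),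
      U w ∈ Set.Icc μm μ ∧ wB μ (U w) = w)
    (hU2 : ∀ w ∈ Set.Icc (3 * Real.pi / 2) (5 * Real.pi / 2),
      U w ∈ Set.Icc μm μ ∧ wA μ (U w) = w - 2 * Real.pi) :
    KBessel ((r : ℂ) + ((y * Real.cosh μ : ℝ) : ℂ) * Complex.I) y =
      (1 / 2) * Complex.exp (Complex.I * ((y * (Real.sinh μ - μ * Real.cosh μ) : ℝ) : ℂ)) *
        (∫ u in Set.Ioi μ,
          Complex.exp (-(y : ℂ) * ((ψA μ u : ℝ) : ℂ)) *
            Complex.exp (-(r : ℂ) * (u : ℂ)) *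
            Complex.exp (Complex.I * (r : ℂ) * ((wA μ u : ℝ) : ℂ)) *
            (1 - Complex.I * ((deriv (wA μ) u : ℝ) : ℂ)))
      + (1 / 2) * Complex.exp (-(Complex.I * ((y * (Real.sinh μ - μ * Real.cosh μ) : ℝ) : ℂ))) *
        (∫ u in Set.Ioi μ,
          Complex.exp (-(y : ℂ) * ((ψA μ u : ℝ) : ℂ)) *
            Complex.exp ((r : ℂ) * (u : ℂ)) *
            Complex.exp (Complex.I * (r : ℂ) * ((wA μ u : ℝ) : ℂ)) *
            (1 + Complex.I * ((deriv (wA μ) u : ℝ) : ℂ)))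
      + (1 / 2) * Complex.exp (Complex.I * ((y * (Real.sinh μ - μ * Real.cosh μ) : ℝ) : ℂ)) *
        (1 / (1 - Complex.exp (((-(2 * Real.pi * (y * Real.cosh μ)) : ℝ) : ℂ) +
            2 * (Real.pi : ℂ) * (r : ℂ) * Complex.I))) *
        (∫ w in (Real.pi / 2)..(5 * Real.pi / 2),
          Complex.exp (-(y : ℂ) *
              ((Real.cosh (U w) * Real.cos w + w * Real.cosh μ : ℝ) : ℂ)) *
            Complex.exp (-(r : ℂ) * ((U w : ℝ) : ℂ)) *
            Complex.exp (Complex.I * (r : ℂ) * (w : ℂ)) *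
            (-((deriv U w : ℝ) : ℂ) + Complex.I))
      - (1 / 2) * Complex.exp (-(Complex.I * ((y * (Real.sinh μ - μ * Real.cosh μ) : ℝ) : ℂ))) *
        (1 / (1 - Complex.exp (((-(2 * Real.pi * (y * Real.cosh μ)) : ℝ) : ℂ) +
            2 * (Real.pi : ℂ) * (r : ℂ) * Complex.I))) *
        (∫ w in (Real.pi / 2)..(5 * Real.pi / 2),
          Complex.exp (-(y : ℂ) *
              ((Real.cosh (U w) * Real.cos w + w * Real.cosh μ : ℝ) : ℂ)) *
            Complex.exp ((r : ℂ) * ((U w : ℝ) : ℂ)) *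
            Complex.exp (Complex.I * (r : ℂ) * (w : ℂ)) *
            (((deriv U w : ℝ) : ℂ) + Complex.I)) := by
  have ht : 0 < y * Real.cosh μ := by positivity
  have hU : ∀ w ∈ Set.Icc (Real.pi / 2) (5 * Real.pi / 2),
      U w ∈ Set.Icc μm μ ∧ gContour μ (U w) = Real.sin w := fun w hw =>
    gContour_closedContour hμm hμmμ hgμm hU1 hU2 hw
  obtain ⟨G, hG⟩ := exists_primitive_kBesselIntegrand
    (r + (y * Real.cosh μ : ℝ) * Complex.I) y
  obtain ⟨L, hL⟩ := exists_tendsto_primitive (σ := 1) (.inl rfl) r ht.le hy hG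
  obtain ⟨L', hL'⟩ := exists_tendsto_primitive (σ := -1) (.inr rfl) r ht.le hy hG
  have hK : KBessel (r + (y * Real.cosh μ : ℝ) * Complex.I) y = 1 / 2 * (L - L') := by
    rw [← integral_kBesselIntegrand_real r ht.le hy hG hL hL', KBessel]
    simp only [kBesselIntegrand, Complex.ofReal_cosh]
  have hleft := exp_mul_integral_wA (.inr rfl) r hμ hy hG hL'
  have hright := exp_mul_integral_wA (.inl rfl) r hμ hy hG hL
  have hleft' := exp_mul_integral_closedContour (.inr rfl) r y hμm hμmμ hU hG
  have hright' := exp_mul_integral_closedContour (.inl rfl) r y hμm hμmμ hU hG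
  have hperiod := primitive_add_two_pi_I hG
    (((-1 : ℝ) : ℂ) * μ + (Real.pi / 2 : ℝ) * Complex.I)
    (((1 : ℝ) : ℂ) * μ + (Real.pi / 2 : ℝ) * Complex.I)
  have hq : 2 * Real.pi * Complex.I * (r + (y * Real.cosh μ : ℝ) * Complex.I) =
      ((-(2 * Real.pi * (y * Real.cosh μ)) : ℝ) : ℂ) + 2 * Real.pi * r * Complex.I := by
    simp only [Complex.ofReal_neg, Complex.ofReal_mul, Complex.ofReal_ofNat]
    linear_combination (2 * Real.pi * y * Complex.ofReal (Real.cosh μ)) * Complex.I_mul_I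
  rw [hq] at hperiod
  have hk : 1 / (1 - Complex.exp (((-(2 * Real.pi * (y * Real.cosh μ)) : ℝ) : ℂ) +
      2 * Real.pi * r * Complex.I)) * (1 - Complex.exp
      (((-(2 * Real.pi * (y * Real.cosh μ)) : ℝ) : ℂ) + 2 * Real.pi * r * Complex.I)) = 1 := by
    refine one_div_mul_cancel (sub_ne_zero.2 fun h => ?_)
    have hnorm := congrArg norm h
    rw [norm_one, Complex.norm_exp, eq_comm, Real.exp_eq_one_iff] at hnorm
    simp only [Complex.add_re, Complex.ofReal_re, Complex.mul_re, Complex.mul_im,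
      Complex.I_re, Complex.I_im, Complex.ofReal_im, Complex.re_ofNat, Complex.im_ofNat] at hnorm
    nlinarith [mul_pos Real.pi_pos ht]
  simp only [Complex.ofReal_neg (1 : ℝ), Complex.ofReal_one, neg_one_mul, neg_neg, one_mul,
    ← sub_eq_add_neg] at hleft hright hleft' hright' hperiod
  set k := 1 / (1 - Complex.exp (((-(2 * Real.pi * (y * Real.cosh μ)) : ℝ) : ℂ) +
      2 * Real.pi * r * Complex.I))
  linear_combination hK - 1 / 2 * hleft - 1 / 2 * hright - k / 2 * hleft' + k / 2 * hright' +
    k / 2 * hperiod - (G (μ + (Real.pi / 2 : ℝ) * Complex.I) -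
      G (-μ + (Real.pi / 2 : ℝ) * Complex.I)) / 2 * hk
end

section
/- Let w(u) = arcsin(u/sinh u) for u ≠ 0 and w(0) = π/2. Then as u → 0, cosh u · cos(w(u)) + w(u) = π/2 + (4/(9√3)) |u|³ + O(u⁵). -/
open Filter Topology Asymptotics

/-- The steepest-descent height function for the case `θ = π/2`:
`w(u) = arcsin(u / sinh u)` with `w(0) = π/2`. -/
noncomputable def wSD2 (u : ℝ) : ℝ :=
  if u = 0 then Real.pi / 2 else Real.arcsin (u / Real.sinh u)

theorem abs_sinh_sub_cubic_le {x : ℝ} (hx : |x| ≤ 1) :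
    |Real.sinh x - (x + x ^ 3 / 6)| ≤ |x| ^ 5 / 100 := by
  have h₁ := Real.exp_bound hx (n := 5) (by norm_num)
  have h₂ := Real.exp_bound (x := -x) (by rwa [abs_neg]) (n := 5) (by norm_num)
  rw [abs_neg] at h₂
  simp only [Finset.sum_range_succ, Finset.sum_range_zero, Nat.factorial] at h₁ h₂
  norm_num at h₁ h₂
  rw [Real.sinh_eq]
  rw [abs_le] at *
  constructor <;> linarith

theorem abs_cosh_sub_quadratic_le {x : ℝ} (hx : |x| ≤ 1) :
    |Real.cosh x - (1 + x ^ 2 / 2)| ≤ |x| ^ 4 := by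
  have h₁ := Real.exp_bound hx (n := 4) (by norm_num)
  have h₂ := Real.exp_bound (x := -x) (by rwa [abs_neg]) (n := 4) (by norm_num)
  rw [abs_neg] at h₂
  simp only [Finset.sum_range_succ, Finset.sum_range_zero, Nat.factorial] at h₁ h₂
  norm_num at h₁ h₂
  have h₃ : 0 ≤ |x| ^ 4 := by positivity
  rw [Real.cosh_eq]
  rw [abs_le] at h₁ h₂ ⊢
  constructor <;> linarith

theorem abs_sin_sub_cubic_le {x : ℝ} (hx : |x| ≤ 1) :
    |Real.sin x - (x - x ^ 3 / 6)| ≤ |x| ^ 5 / 100 := by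
  have h := Complex.exp_bound (x := x * Complex.I) (by simpa using hx) (n := 5) (by norm_num)
  have him := (Complex.abs_im_le_norm _).trans h
  have hI : (x * Complex.I) ^ 2 = ((-x ^ 2 : ℝ) : ℂ) := by
    rw [mul_pow, Complex.I_sq]; push_cast; ring
  have hI₃ : (x * Complex.I) ^ 3 = ((-x ^ 3 : ℝ) : ℂ) * Complex.I := by
    rw [pow_succ, hI]; push_cast; ring
  have hI₄ : (x * Complex.I) ^ 4 = ((x ^ 4 : ℝ) : ℂ) := by
    rw [pow_succ, hI₃, mul_mul_mul_comm, Complex.I_mul_I]; push_cast; ring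
  have hsum : (Complex.exp (x * Complex.I) -
      ∑ m ∈ Finset.range 5, (x * Complex.I) ^ m / (m.factorial : ℂ)).im =
      Real.sin x - (x - x ^ 3 / 6) := by
    have : ∑ m ∈ Finset.range 5, (x * Complex.I) ^ m / (m.factorial : ℂ) =
        ((1 - x ^ 2 / 2 + x ^ 4 / 24 : ℝ) : ℂ) + ((x - x ^ 3 / 6 : ℝ) : ℂ) * Complex.I := by
      simp only [Finset.sum_range_succ, Finset.sum_range_zero, hI, hI₃, hI₄, Nat.factorial]
      push_cast
      ring
    rw [this, Complex.sub_im, Complex.exp_ofReal_mul_I_im, Complex.add_im,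
      Complex.ofReal_im, Complex.im_ofReal_mul, Complex.I_im]
    ring
  rw [hsum] at him
  refine him.trans (le_of_eq ?_)
  rw [norm_mul, Complex.norm_I, Complex.norm_real, Real.norm_eq_abs]
  norm_num [Nat.factorial]
  ring

theorem abs_one_sub_sq_div_sinh_sub_le {u : ℝ} (hu : 0 < u) (hu₁ : u ≤ 1) :
    |1 - (u / Real.sinh u) ^ 2 - u ^ 2 / 3| ≤ u ^ 4 := by
  have hs := abs_sinh_sub_cubic_le (x := u) (by rwa [abs_of_pos hu])
  rw [abs_of_pos hu] at hs
  obtain ⟨q, hq⟩ : ∃ q, Real.sinh u = u * (1 + u ^ 2 / 6 + q) :=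
    ⟨Real.sinh u / u - 1 - u ^ 2 / 6, by field_simp; ring⟩
  have hqle : |q| ≤ (u ^ 2) ^ 2 / 100 := by
    have e : Real.sinh u - (u + u ^ 3 / 6) = u * q := by rw [hq]; ring
    rw [e, abs_mul, abs_of_pos hu] at hs
    refine le_of_mul_le_mul_left (hs.trans (le_of_eq ?_)) hu
    ring
  have hS : 1 ≤ 1 + u ^ 2 / 6 + q := by
    have := Real.self_le_sinh_iff.2 hu.le
    rw [hq] at this
    exact le_of_mul_le_mul_left (by simpa using this) hu
  have hquot : u / Real.sinh u = 1 / (1 + u ^ 2 / 6 + q) := by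
    rw [hq]; field_simp
  rw [hquot]
  have ht : u ^ 2 ≤ 1 := by nlinarith
  have ht₀ : 0 ≤ u ^ 2 := by positivity
  have hu₄ : u ^ 4 = (u ^ 2) ^ 2 := by ring
  rw [hu₄]
  generalize u ^ 2 = t at *
  have e : 1 - (1 / (1 + t / 6 + q)) ^ 2 - t / 3 =
      (-t ^ 2 / 9 + (1 - t / 3) * (t ^ 2 / 36 + 2 * (q * (1 + t / 6)) + q ^ 2)) /
        (1 + t / 6 + q) ^ 2 := by
    have hne : 1 + t / 6 + q ≠ 0 := by linarith
    rw [eq_div_iff (pow_ne_zero 2 hne), div_pow, sub_mul, sub_mul,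
      div_mul_cancel₀ _ (pow_ne_zero 2 hne)]
    ring
  have ht₂ : t ^ 2 ≤ 1 := by nlinarith
  have hnum : |-t ^ 2 / 9 + (1 - t / 3) * (t ^ 2 / 36 + 2 * (q * (1 + t / 6)) + q ^ 2)| ≤
      t ^ 2 := by
    have h₁ : |q * (1 + t / 6)| ≤ t ^ 2 / 50 := by
      rw [abs_mul, abs_of_nonneg (by linarith : 0 ≤ 1 + t / 6)]
      nlinarith [abs_nonneg q]
    have h₂ : q ^ 2 ≤ t ^ 2 / 100 := by
      rw [← sq_abs]
      nlinarith [abs_nonneg q]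
    have h₃ : |t ^ 2 / 36 + 2 * (q * (1 + t / 6)) + q ^ 2| ≤ t ^ 2 / 2 := by
      rw [abs_le] at h₁ ⊢
      constructor <;> nlinarith
    have h₄ : |(1 - t / 3) * (t ^ 2 / 36 + 2 * (q * (1 + t / 6)) + q ^ 2)| ≤ t ^ 2 / 2 := by
      rw [abs_mul, abs_of_nonneg (by linarith : 0 ≤ 1 - t / 3)]
      refine (mul_le_of_le_one_left (abs_nonneg _) (by linarith)).trans h₃
    rw [abs_le] at h₄ ⊢
    constructor <;> nlinarith
  rw [e, abs_div, abs_of_nonneg (sq_nonneg (1 + t / 6 + q))]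
  exact (div_le_self (abs_nonneg _) (by nlinarith)).trans hnum

theorem abs_cosh_mul_sin_sub_le {u d a : ℝ} (hu : 0 < u) (hu₁ : u ≤ 1 / 4) (ha : 0 < a)
    (hau : a ^ 2 = u ^ 2 / 3) (hd₀ : 0 ≤ d) (hd₁ : d ≤ Real.pi / 2)
    (hd : Real.cos d = u / Real.sinh u) :
    |Real.cosh u * Real.sin d - d - 4 / 3 * a ^ 3| ≤ 1000 * u ^ 5 := by
  have hc := abs_one_sub_sq_div_sinh_sub_le hu (by linarith)
  rw [← hd, ← Real.sin_sq, ← hau] at hc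
  have hs₀ : 0 ≤ Real.sin d := Real.sin_nonneg_of_nonneg_of_le_pi hd₀ (by linarith)
  have hau₁ : a ≤ u := by nlinarith
  have hau₂ : u ≤ 2 * a := by nlinarith
  have hca : |Real.sin d - a| ≤ 2 * u ^ 3 := by
    have e : Real.sin d ^ 2 - a ^ 2 = (Real.sin d - a) * (Real.sin d + a) := by ring
    rw [e, abs_mul, abs_of_pos (by linarith : 0 < Real.sin d + a)] at hc
    have h₁ : |Real.sin d - a| * a ≤ u ^ 4 :=
      (mul_le_mul_of_nonneg_left (by linarith) (abs_nonneg _)).trans hc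
    refine le_of_mul_le_mul_right (h₁.trans ?_) ha
    nlinarith [mul_le_mul_of_nonneg_left hau₂ (by positivity : 0 ≤ u ^ 3)]
  have hu₂ : u ^ 2 ≤ 1 / 16 := by nlinarith
  have hu₃ : u ^ 3 ≤ u / 16 := by nlinarith
  have hs₁ : Real.sin d ≤ 2 * u := by linarith [(abs_le.1 hca).2]
  have hds : d ≤ 2 * Real.sin d := by
    have h₁ := Real.mul_le_sin hd₀ hd₁
    have h₂ : 1 / 2 ≤ 2 / Real.pi := by
      rw [div_le_div_iff₀ two_pos Real.pi_pos]; linarith [Real.pi_le_four]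
    nlinarith
  have hdu : d ≤ 4 * u := by linarith
  have hsin := abs_sin_sub_cubic_le (x := d) (by rw [abs_of_nonneg hd₀]; linarith)
  rw [abs_of_nonneg hd₀] at hsin
  have hd₃ : d ^ 3 ≤ 64 * u ^ 3 :=
    (pow_le_pow_left₀ hd₀ hdu 3).trans (le_of_eq (by ring))
  have hd₅ : d ^ 5 ≤ 1024 * u ^ 5 :=
    (pow_le_pow_left₀ hd₀ hdu 5).trans (le_of_eq (by ring))
  have hd₅₃ : d ^ 5 ≤ d ^ 3 := pow_le_pow_of_le_one hd₀ (by linarith) (by norm_num)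
  have hda : |d - a| ≤ 66 * u ^ 3 := by
    have : 0 ≤ d ^ 3 := by positivity
    rw [abs_le] at hca hsin ⊢
    constructor <;> linarith
  have hcube : |d ^ 3 - a ^ 3| ≤ 1386 * u ^ 5 := by
    have e : d ^ 3 - a ^ 3 = (d - a) * (d ^ 2 + d * a + a ^ 2) := by ring
    have h₁ : d ^ 2 + d * a + a ^ 2 ≤ 21 * u ^ 2 := by nlinarith
    rw [e, abs_mul, abs_of_nonneg (by positivity : 0 ≤ d ^ 2 + d * a + a ^ 2)]
    exact (mul_le_mul hda h₁ (by positivity) (by positivity)).trans (le_of_eq (by ring))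
  have hcosh := abs_cosh_sub_quadratic_le (x := u) (by rw [abs_of_pos hu]; linarith)
  rw [abs_of_pos hu] at hcosh
  have hprod : |Real.sin d * (Real.cosh u - (1 + u ^ 2 / 2))| ≤ 2 * u ^ 5 := by
    rw [abs_mul, abs_of_nonneg hs₀]
    exact (mul_le_mul hs₁ hcosh (abs_nonneg _) (by linarith)).trans (le_of_eq (by ring))
  have hquad : |(Real.sin d - a) * u ^ 2| ≤ 2 * u ^ 5 := by
    rw [abs_mul, abs_of_nonneg (sq_nonneg u)]
    exact (mul_le_mul_of_nonneg_right hca (sq_nonneg u)).trans (le_of_eq (by ring))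
  have e : Real.cosh u * Real.sin d - d - 4 / 3 * a ^ 3 =
      Real.sin d * (Real.cosh u - (1 + u ^ 2 / 2)) + (Real.sin d - a) * u ^ 2 / 2 +
        (Real.sin d - (d - d ^ 3 / 6)) - (d ^ 3 - a ^ 3) / 6 := by
    linear_combination (-3 / 2 * a) * hau
  have : 0 ≤ u ^ 5 := by positivity
  rw [e]
  rw [abs_le] at *
  constructor <;> linarith

theorem wSD2_neg (u : ℝ) : wSD2 (-u) = wSD2 u := by
  simp [wSD2, Real.sinh_neg, neg_div_neg_eq]

theorem abs_phase_sub_le_of_pos {u : ℝ} (hu : 0 < u) (hu₁ : u ≤ 1 / 4) :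
    |Real.cosh u * Real.cos (wSD2 u) + wSD2 u -
        (Real.pi / 2 + (4 / (9 * Real.sqrt 3)) * u ^ 3)| ≤ 1000 * u ^ 5 := by
  have hsinh : 0 < Real.sinh u := Real.sinh_pos_iff.2 hu
  have hq₀ : 0 ≤ u / Real.sinh u := by positivity
  have hq₁ : u / Real.sinh u ≤ 1 :=
    (div_le_one hsinh).2 (Real.self_le_sinh_iff.2 hu.le)
  have hw : wSD2 u = Real.pi / 2 - Real.arccos (u / Real.sinh u) := by
    rw [wSD2, if_neg hu.ne', Real.arcsin_eq_pi_div_two_sub_arccos]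
  have h3 : Real.sqrt 3 ^ 2 = 3 := Real.sq_sqrt (by norm_num)
  have h := abs_cosh_mul_sin_sub_le (a := u / Real.sqrt 3) hu hu₁ (by positivity)
    (by rw [div_pow, h3]) (Real.arccos_nonneg _) (Real.arccos_le_pi_div_two.2 hq₀)
    (Real.cos_arccos (by linarith) hq₁)
  rw [hw, Real.cos_pi_div_two_sub]
  convert h using 2
  have h33 : Real.sqrt 3 ^ 3 = 3 * Real.sqrt 3 := by rw [pow_succ, h3]
  rw [div_pow, h33]
  field_simp
  ring

theorem phase_expansion_order_two_saddle :
    (fun u : ℝ => Real.cosh u * Real.cos (wSD2 u) + wSD2 u -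
        (Real.pi / 2 + (4 / (9 * Real.sqrt 3)) * |u| ^ 3)) =O[𝓝 0]
      (fun u : ℝ => u ^ 5) := by
  refine IsBigO.of_bound 1000 ?_
  filter_upwards [Metric.ball_mem_nhds (0 : ℝ) (by norm_num : (0 : ℝ) < 1 / 4)] with u hu
  rw [mem_ball_zero_iff, Real.norm_eq_abs] at hu
  rw [norm_pow, Real.norm_eq_abs, Real.norm_eq_abs]
  rcases lt_trichotomy u 0 with h | rfl | h
  · have := abs_phase_sub_le_of_pos (u := -u) (by linarith) (by rw [← abs_of_neg h]; exact hu.le)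
    rwa [wSD2_neg, Real.cosh_neg, ← abs_of_neg h] at this
  · simp [wSD2]
  · rw [abs_of_pos h] at hu ⊢
    exact abs_phase_sub_le_of_pos h hu.le
end

section
/- Let w(u) = arcsin(u/sinh u) for u ≠ 0 and w(0) = π/2. Then the derivative w'(u) satisfies w'(u) → −1/√3 as u → 0⁺ and w'(u) → +1/√3 as u → 0⁻; in particular w'(u) = −√(1/3) + O(u²) for small u > 0 and w'(u) = √(1/3) + O(u²) for small u < 0. -/
open Filter Topology Asymptotics

theorem exp_neg_sub_sum_range_isBigO_pow (n : ℕ) :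
    (fun u : ℝ => Real.exp (-u) - ∑ i ∈ Finset.range n, (-u) ^ i / (i.factorial : ℝ))
      =O[𝓝 0] (fun u : ℝ => u ^ n) := by
  have h := (Real.exp_sub_sum_range_isBigO_pow n).comp_tendsto (k := fun u : ℝ => -u) (l' := 𝓝 0)
    (by simpa using continuous_neg.tendsto (0 : ℝ))
  exact h.trans (isBigO_of_le _ fun u => by simp)

theorem sinh_sub_isBigO :
    (fun u : ℝ => Real.sinh u - u - u ^ 3 / 6) =O[𝓝 0] (fun u : ℝ => u ^ 5) := by
  have h := Real.exp_sub_sum_range_isBigO_pow 5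
  have hn := exp_neg_sub_sum_range_isBigO_pow 5
  refine ((h.sub hn).const_mul_left (1 / 2)).congr_left fun u => ?_
  simp [Finset.sum_range_succ, Nat.factorial, Real.sinh_eq]
  ring

theorem cosh_sub_isBigO :
    (fun u : ℝ => Real.cosh u - 1 - u ^ 2 / 2) =O[𝓝 0] (fun u : ℝ => u ^ 4) := by
  have h := Real.exp_sub_sum_range_isBigO_pow 4
  have hn := exp_neg_sub_sum_range_isBigO_pow 4
  refine ((h.add hn).const_mul_left (1 / 2)).congr_left fun u => ?_
  simp [Finset.sum_range_succ, Nat.factorial, Real.cosh_eq]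
  ring

/-- The absolute value of `deriv wSD2 u` for `u ≠ 0`, as a function of `q = (cosh u - 1) / u ^ 2`,
`p = (sinh u / u - 1) / u ^ 2` and `s = sinh u / u`. -/
noncomputable def slopeFun (x : ℝ × ℝ × ℝ) : ℝ :=
  (x.1 - x.2.1) / (x.2.2 * √(x.2.1 * (x.2.2 + 1)))

/-- The arguments at which `slopeFun` gives the absolute value of `deriv wSD2 u`. -/
noncomputable def slopeArg (u : ℝ) : ℝ × ℝ × ℝ :=
  ((Real.cosh u - 1) / u ^ 2, (Real.sinh u / u - 1) / u ^ 2, Real.sinh u / u)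

theorem slopeArg_sub_isBigO :
    (fun u : ℝ => slopeArg u - (1 / 2, 1 / 6, 1)) =O[𝓝[≠] 0] (fun u : ℝ => u ^ 2) := by
  have hne : ∀ᶠ u : ℝ in 𝓝[≠] 0, u ≠ 0 := self_mem_nhdsWithin
  have hq : (fun u : ℝ => (Real.cosh u - 1) / u ^ 2 - 1 / 2) =O[𝓝[≠] 0] (fun u : ℝ => u ^ 2) := by
    refine ((cosh_sub_isBigO.mono nhdsWithin_le_nhds).mul
      (isBigO_refl (fun u : ℝ => (u ^ 2)⁻¹) (𝓝[≠] 0))).congr' ?_ ?_ <;>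
    · filter_upwards [hne] with u hu
      field_simp
  have hp : (fun u : ℝ => (Real.sinh u / u - 1) / u ^ 2 - 1 / 6)
      =O[𝓝[≠] 0] (fun u : ℝ => u ^ 2) := by
    refine ((sinh_sub_isBigO.mono nhdsWithin_le_nhds).mul
      (isBigO_refl (fun u : ℝ => (u ^ 3)⁻¹) (𝓝[≠] 0))).congr' ?_ ?_ <;>
    · filter_upwards [hne] with u hu
      field_simp
  have hs : (fun u : ℝ => Real.sinh u / u - 1) =O[𝓝[≠] 0] (fun u : ℝ => u ^ 2) := by
    have h0 : Tendsto (fun u : ℝ => u ^ 2) (𝓝[≠] 0) (𝓝 0) :=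
      tendsto_nhdsWithin_of_tendsto_nhds (by simpa using (continuous_pow 2).tendsto (0 : ℝ))
    have hb := (tendsto_sub_nhds_zero_iff.1 (hp.trans_tendsto h0)).isBigO_one ℝ
    refine (hb.mul (isBigO_refl (fun u : ℝ => u ^ 2) (𝓝[≠] 0))).congr' ?_ ?_
    · filter_upwards [hne] with u hu
      field_simp
    · simp
  exact hq.prod_left (hp.prod_left hs)

theorem slopeFun_base : slopeFun (1 / 2, 1 / 6, 1) = √(1 / 3) := by
  have h : (0 : ℝ) < √(1 / 3) := by positivity
  have h2 : √(1 / 3 : ℝ) ^ 2 = 1 / 3 := Real.sq_sqrt (by norm_num)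
  have h3 : (1 / 6 : ℝ) * (1 + 1) = 1 / 3 := by norm_num
  rw [slopeFun, h3, div_eq_iff (by positivity)]
  linarith

theorem slopeFun_slopeArg_sub_isBigO :
    (fun u : ℝ => slopeFun (slopeArg u) - √(1 / 3)) =O[𝓝[≠] 0] (fun u : ℝ => u ^ 2) := by
  have hd : DifferentiableAt ℝ slopeFun (1 / 2, 1 / 6, 1) := by
    unfold slopeFun
    have hr : DifferentiableAt ℝ (fun x : ℝ × ℝ × ℝ => √(x.2.1 * (x.2.2 + 1))) (1 / 2, 1 / 6, 1) :=
      DifferentiableAt.sqrt (by fun_prop) (by norm_num)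
    have hm : DifferentiableAt ℝ (fun x : ℝ × ℝ × ℝ => x.2.2 * √(x.2.1 * (x.2.2 + 1)))
        (1 / 2, 1 / 6, 1) := DifferentiableAt.fun_mul (by fun_prop) hr
    simp only [div_eq_mul_inv _ (_ * √_)]
    exact DifferentiableAt.fun_mul (by fun_prop) (hm.fun_inv (by positivity))
  have h0 : Tendsto (fun u : ℝ => u ^ 2) (𝓝[≠] 0) (𝓝 0) :=
    tendsto_nhdsWithin_of_tendsto_nhds (by simpa using (continuous_pow 2).tendsto (0 : ℝ))
  have ht := tendsto_sub_nhds_zero_iff.1 (slopeArg_sub_isBigO.trans_tendsto h0)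
  have := (hd.isBigO_sub.comp_tendsto ht).trans slopeArg_sub_isBigO
  simpa only [Function.comp_def, slopeFun_base] using this

theorem one_lt_sinh_div {u : ℝ} (hu : u ≠ 0) : 1 < Real.sinh u / u := by
  rcases hu.lt_or_gt with h | h
  · rw [lt_div_iff_of_neg h, one_mul]
    exact Real.sinh_lt_self_iff.2 h
  · rw [lt_div_iff₀ h, one_mul]
    exact Real.self_lt_sinh_iff.2 h

theorem deriv_wSD2 {u : ℝ} (hu : u ≠ 0) :
    deriv wSD2 u = -(u / |u|) * slopeFun (slopeArg u) := by
  have hs := one_lt_sinh_div hu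
  have hsinh : Real.sinh u ≠ 0 := Real.sinh_ne_zero.2 hu
  have hinv : u / Real.sinh u = (Real.sinh u / u)⁻¹ := (inv_div _ _).symm
  have hlt : u / Real.sinh u < 1 := hinv ▸ inv_lt_one_of_one_lt₀ hs
  have hpos : 0 < u / Real.sinh u := hinv ▸ inv_pos.2 (by linarith)
  have heq : wSD2 =ᶠ[𝓝 u] fun v => Real.arcsin (v / Real.sinh v) := by
    filter_upwards [isOpen_ne.mem_nhds hu] with v hv
    exact if_neg hv
  have hd := (Real.hasDerivAt_arcsin (by linarith) hlt.ne).comp u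
    ((hasDerivAt_id u).div (Real.hasDerivAt_sinh u) hsinh)
  rw [heq.deriv_eq]
  refine hd.deriv.trans ?_
  have hb : 0 < √((Real.sinh u / u - 1) / u ^ 2 * (Real.sinh u / u + 1)) :=
    Real.sqrt_pos.2 (mul_pos (div_pos (by linarith) (by positivity)) (by linarith))
  have hsq : √(1 - (u / Real.sinh u) ^ 2) =
      |u| * √((Real.sinh u / u - 1) / u ^ 2 * (Real.sinh u / u + 1)) / (Real.sinh u / u) := by
    have hB := Real.sq_sqrt (Real.sqrt_pos.1 hb).le
    have hs0 : 0 < Real.sinh u / u := by linarith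
    refine Eq.trans ?_ (Real.sqrt_sq (by positivity))
    rw [div_pow (|u| * _), mul_pow, hB, sq_abs]
    congr 1
    field_simp
    ring
  simp only [id, slopeFun, slopeArg]
  rw [hsq]
  field_simp
  ring

theorem deriv_w_order_two_saddle :
    Tendsto (deriv wSD2) (𝓝[>] 0) (𝓝 (-(1 / Real.sqrt 3))) ∧
    Tendsto (deriv wSD2) (𝓝[<] 0) (𝓝 (1 / Real.sqrt 3)) ∧
    (fun u : ℝ => deriv wSD2 u - (-Real.sqrt (1 / 3))) =O[𝓝[>] (0 : ℝ)]
      (fun u : ℝ => u ^ 2) ∧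
    (fun u : ℝ => deriv wSD2 u - Real.sqrt (1 / 3)) =O[𝓝[<] (0 : ℝ)]
      (fun u : ℝ => u ^ 2) := by
  have hpos : (fun u : ℝ => deriv wSD2 u - (-Real.sqrt (1 / 3))) =O[𝓝[>] (0 : ℝ)]
      (fun u : ℝ => u ^ 2) := by
    refine (slopeFun_slopeArg_sub_isBigO.mono
      (nhdsWithin_mono 0 fun u (hu : 0 < u) => hu.ne')).neg_left.congr' ?_ .rfl
    filter_upwards [self_mem_nhdsWithin] with u (hu : 0 < u)
    rw [deriv_wSD2 hu.ne', abs_of_pos hu, div_self hu.ne']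
    ring
  have hneg : (fun u : ℝ => deriv wSD2 u - Real.sqrt (1 / 3)) =O[𝓝[<] (0 : ℝ)]
      (fun u : ℝ => u ^ 2) := by
    refine (slopeFun_slopeArg_sub_isBigO.mono
      (nhdsWithin_mono 0 fun u (hu : u < 0) => hu.ne)).congr' ?_ .rfl
    filter_upwards [self_mem_nhdsWithin] with u (hu : u < 0)
    rw [deriv_wSD2 hu.ne, abs_of_neg hu, div_neg, div_self hu.ne]
    ring
  have h0 : Tendsto (fun u : ℝ => u ^ 2) (𝓝 0) (𝓝 0) := by
    simpa using (continuous_pow 2).tendsto (0 : ℝ)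
  have hsqrt : 1 / √3 = √(1 / 3) := by simp
  rw [hsqrt]
  exact ⟨tendsto_sub_nhds_zero_iff.1 (hpos.trans_tendsto (h0.mono_left nhdsWithin_le_nhds)),
    tendsto_sub_nhds_zero_iff.1 (hneg.trans_tendsto (h0.mono_left nhdsWithin_le_nhds)),
    hpos, hneg⟩
end
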